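/- If H is a complete Halin graph with maximum degree Δ ≥ 11, then ch'_star(H) ≤ ⌊3Δ/2⌋. -/

import Mathlib

open SimpleGraph
open scoped Classical

/-- Two edges (as unordered pairs of vertices) are adjacent:
they are distinct and share an endpoint. -/
def EdgeAdj {V : Type*} (e₁ e₂ : Sym2 V) : Prop :=
  e₁ ≠ e₂ ∧ ∃ v, v ∈ e₁ ∧ v ∈ e₂

/-- `φ` is a star edge coloring of `G`: a proper edge coloring such that
no path of length four and no cycle of length four is bichromatic. -/
def IsStarEdgeColoring {V : Type*} (G : SimpleGraph V) (φ : Sym2 V → ℕ) : Prop :=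
  (∀ e₁ ∈ G.edgeSet, ∀ e₂ ∈ G.edgeSet, EdgeAdj e₁ e₂ → φ e₁ ≠ φ e₂) ∧
  (∀ (u v : V) (p : G.Walk u v), p.IsPath → p.length = 4 →
      ¬ ∃ c₁ c₂ : ℕ, ∀ e ∈ p.edges, φ e = c₁ ∨ φ e = c₂) ∧
  (∀ (u : V) (p : G.Walk u u), p.IsCycle → p.length = 4 →
      ¬ ∃ c₁ c₂ : ℕ, ∀ e ∈ p.edges, φ e = c₁ ∨ φ e = c₂)

/-- `G` has a star edge coloring using colors `< k`. -/
def StarColorable {V : Type*} (G : SimpleGraph V) (k : ℕ) : Prop :=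
  ∃ φ : Sym2 V → ℕ, (∀ e ∈ G.edgeSet, φ e < k) ∧ IsStarEdgeColoring G φ

/-- The star chromatic index of `G`. -/
noncomputable def starChromaticIndex {V : Type*} (G : SimpleGraph V) : ℕ :=
  sInf {k | StarColorable G k}

/-- `G` is star `k`-edge choosable. -/
def StarChoosable {V : Type*} (G : SimpleGraph V) (k : ℕ) : Prop :=
  ∀ L : Sym2 V → Finset ℕ, (∀ e ∈ G.edgeSet, k ≤ (L e).card) →
    ∃ φ : Sym2 V → ℕ, (∀ e ∈ G.edgeSet, φ e ∈ L e) ∧ IsStarEdgeColoring G φ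

/-- The list star chromatic index of `G`. -/
noncomputable def listStarChromaticIndex {V : Type*} (G : SimpleGraph V) : ℕ :=
  sInf {k | StarChoosable G k}

/-- The maximum Ore-degree `θ(G) = max_{xy ∈ E(G)} (d(x) + d(y))`. -/
noncomputable def oreDegree {V : Type*} (G : SimpleGraph V) [Fintype V] : ℕ :=
  sSup {n | ∃ x y, G.Adj x y ∧ n = G.degree x + G.degree y}

/-- `H = T ∪ C` is a generalized Halin graph with characteristic tree `T` and
adjoint cycle `C`: `T` is a tree with `Δ(T) ≥ 3`, `C` is a cycle (a connected
`2`-regular subgraph on its support) passing exactly through the leaves of `T`,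
the edges of `T` and `C` are disjoint, and `H` is their union. -/
def IsGenHalin {V : Type*} [Fintype V] (H T C : SimpleGraph V) : Prop :=
  T.IsTree ∧ 3 ≤ T.maxDegree ∧ H = T ⊔ C ∧ Disjoint T.edgeSet C.edgeSet ∧
  (∀ v, T.degree v = 1 ↔ C.degree v = 2) ∧
  (∀ v, C.degree v = 0 ∨ C.degree v = 2) ∧
  (∀ u v, C.degree u = 2 → C.degree v = 2 → C.Reachable u v)

/-- A Halin graph: a generalized Halin graph whose characteristic tree has
no vertex of degree `2`. -/
def IsHalin {V : Type*} [Fintype V] (H T C : SimpleGraph V) : Prop :=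
  IsGenHalin H T C ∧ ∀ v, T.degree v ≠ 2

/-- A complete Halin graph: all leaves of `T` are at the same distance
from the root. -/
def IsCompleteHalin {V : Type*} [Fintype V] (H T C : SimpleGraph V) : Prop :=
  IsHalin H T C ∧
    ∃ r, ∀ u v, T.degree u = 1 → T.degree v = 1 → T.dist r u = T.dist r v

/-- Systems of distinct representatives when all lists are at least as large as the index set. -/
lemma sdr_exists {α : Type*} (s : Finset α) (L : α → Finset ℕ)
    (hL : ∀ x ∈ s, s.card ≤ (L x).card) :
    ∃ f : α → ℕ, (∀ x ∈ s, f x ∈ L x) ∧ ∀ x ∈ s, ∀ y ∈ s, x ≠ y → f x ≠ f y := by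
  have h := (Finset.all_card_le_biUnion_card_iff_exists_injective
    (fun x : s => L x.1)).1 (by
      intro t
      rcases t.eq_empty_or_nonempty with rfl | ⟨a, ha⟩
      · simp
      · calc t.card ≤ s.card := by simpa using Finset.card_le_univ t
          _ ≤ (L a.1).card := hL a.1 a.2
          _ ≤ _ := Finset.card_le_card (Finset.subset_biUnion_of_mem (fun x : s => L x.1) ha))
  obtain ⟨f, hf, hfm⟩ := h
  refine ⟨fun x => if hx : x ∈ s then f ⟨x, hx⟩ else 0, ?_, ?_⟩
  · intro x hx
    simp only [hx, dif_pos]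
    exact hfm ⟨x, hx⟩
  · intro x hx y hy hxy
    simp only [hx, hy, dif_pos]
    intro h
    exact hxy (congrArg Subtype.val (hf h))

/-- Halving lemma. -/
lemma halving {β : Type*} (X : Finset ℕ) (cls : ℕ → ℕ) (σ : ℕ → β)
    (h2 : ∀ a, (X.filter (fun x => cls x = a)).card ≤ 2) :
    ∃ Y ⊆ X, (∀ x ∈ Y, ∀ y ∈ Y, cls x = cls y → x = y) ∧
      ∀ u, (X.filter (fun x => σ x = u)).card / 2 ≤ (Y.filter (fun x => σ x = u)).card := by
  let U := X.image σ
  let ι := Σ u : U, Fin ((X.filter (fun x => σ x = u.1)).card / 2)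
  let t : ι → Finset ℕ := fun i => (X.filter (fun x => σ x = i.1.1)).image cls
  obtain ⟨f, hf, hfm⟩ := (Finset.all_card_le_biUnion_card_iff_exists_injective t).1 (by
    intro S
    let W := S.image (fun i => i.1)
    have h1 : S.card ≤ ∑ u ∈ W, (X.filter (fun x => σ x = u.1)).card / 2 := by
      have : S ⊆ W.sigma (fun u => (Finset.univ : Finset (Fin ((X.filter (fun x => σ x = u.1)).card / 2)))) := by
        intro i hi
        exact Finset.mem_sigma.2 ⟨Finset.mem_image_of_mem _ hi, Finset.mem_univ _⟩
      calc S.card ≤ _ := Finset.card_le_card this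
        _ = _ := (Finset.card_sigma _ _).trans (by simp)
    let Z := X.filter (fun x => ∃ u ∈ W, σ x = u.1)
    have h3 : ∑ u ∈ W, (X.filter (fun x => σ x = u.1)).card ≤ Z.card := by
      rw [← Finset.card_biUnion]
      · apply Finset.card_le_card
        intro x hx
        simp only [Finset.mem_biUnion, Finset.mem_filter] at hx
        obtain ⟨u, hu, hx, h⟩ := hx
        simp only [Z, Finset.mem_filter]
        exact ⟨hx, u, hu, h⟩
      · intro u _ v _ huv
        rw [Function.onFun, Finset.disjoint_left]
        intro x hx hx'
        simp only [Finset.mem_filter] at hx hx'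
        exact huv (Subtype.ext (hx.2.symm.trans hx'.2))
    have h4 : Z.card ≤ 2 * (S.biUnion t).card := by
      apply Finset.card_le_mul_card_image_of_maps_to (f := cls) (t := S.biUnion t)
      · intro x hx
        simp only [Z, Finset.mem_filter] at hx
        obtain ⟨hx, u, hu, hxu⟩ := hx
        obtain ⟨i, hi, rfl⟩ := Finset.mem_image.1 hu
        refine Finset.mem_biUnion.2 ⟨i, hi, ?_⟩
        exact Finset.mem_image_of_mem _ (Finset.mem_filter.2 ⟨hx, hxu⟩)
      · intro a _
        refine le_trans (Finset.card_le_card ?_) (h2 a)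
        intro x hx
        simp only [Z, Finset.mem_filter] at hx ⊢
        exact ⟨hx.1.1, hx.2⟩
    have h5 : 2 * ∑ u ∈ W, (X.filter (fun x => σ x = u.1)).card / 2 ≤
        ∑ u ∈ W, (X.filter (fun x => σ x = u.1)).card := by
      rw [Finset.mul_sum]
      exact Finset.sum_le_sum (fun u _ => by omega)
    omega)
  have hg : ∀ i : ι, ∃ x ∈ X, σ x = i.1.1 ∧ cls x = f i := by
    intro i
    obtain ⟨x, hx, hxe⟩ := Finset.mem_image.1 (hfm i)
    simp only [Finset.mem_filter] at hx
    exact ⟨x, hx.1, hx.2, hxe⟩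
  choose g hgX hgσ hgc using hg
  have ginj : Function.Injective g := by
    intro i j hij
    apply hf
    rw [← hgc, ← hgc, hij]
  refine ⟨Finset.univ.image g, ?_, ?_, ?_⟩
  · intro x hx
    obtain ⟨i, _, rfl⟩ := Finset.mem_image.1 hx
    exact hgX i
  · intro x hx y hy hxy
    obtain ⟨i, _, rfl⟩ := Finset.mem_image.1 hx
    obtain ⟨j, _, rfl⟩ := Finset.mem_image.1 hy
    rw [hgc, hgc] at hxy
    rw [hf hxy]
  · intro u
    by_cases hu : u ∈ U
    · have : (Finset.univ : Finset (Fin ((X.filter (fun x => σ x = u)).card / 2))).image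
          (fun j => g ⟨⟨u, hu⟩, j⟩) ⊆ (Finset.univ.image g).filter (fun x => σ x = u) := by
        intro x hx
        obtain ⟨j, _, rfl⟩ := Finset.mem_image.1 hx
        exact Finset.mem_filter.2 ⟨Finset.mem_image_of_mem _ (Finset.mem_univ _), hgσ _⟩
      have h' := Finset.card_le_card this
      rw [Finset.card_image_of_injective] at h'
      · simpa using h'
      · intro a b hab
        exact eq_of_heq (Sigma.mk.inj (ginj hab)).2
    · have : X.filter (fun x => σ x = u) = ∅ := by
        apply Finset.filter_eq_empty_iff.2
        intro x hx hxu
        exact hu (Finset.mem_image.2 ⟨x, hx, hxu⟩)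
      simp [this]

/-- The kernel lemma (Bondy–Boppana–Siegel). -/
lemma kernel_color {α : Type*} (arc : α → α → Prop) (X : Finset α)
    (hker : ∀ W ⊆ X, ∃ K ⊆ W, (∀ a ∈ K, ∀ b ∈ K, ¬ arc a b) ∧
      ∀ v ∈ W, v ∉ K → ∃ w ∈ K, arc v w) :
    ∀ (m : ℕ) (Y : Finset α), Y.card = m → Y ⊆ X → ∀ L : α → Finset ℕ,
      (∀ v ∈ Y, (Y.filter (fun w => arc v w)).card < (L v).card) →
      ∃ f : α → ℕ, (∀ v ∈ Y, f v ∈ L v) ∧ ∀ v ∈ Y, ∀ w ∈ Y, arc v w → f v ≠ f w := by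
  intro m
  induction m using Nat.strong_induction_on with
  | _ m ih =>
    intro Y hYm hYX L hL
    rcases Y.eq_empty_or_nonempty with rfl | ⟨a, ha⟩
    · exact ⟨fun _ => 0, by simp, by simp⟩
    have hLa : 0 < (L a).card := lt_of_le_of_lt (Nat.zero_le _) (hL a ha)
    obtain ⟨q, hq⟩ := Finset.card_pos.1 hLa
    let W := Y.filter (fun v => q ∈ L v)
    obtain ⟨K, hKW, hKi, hKa⟩ := hker W ((Finset.filter_subset _ _).trans hYX)
    have haW : a ∈ W := Finset.mem_filter.2 ⟨ha, hq⟩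
    have hKne : K.Nonempty := by
      by_cases haK : a ∈ K
      · exact ⟨a, haK⟩
      · obtain ⟨w, hw, _⟩ := hKa a haW haK
        exact ⟨w, hw⟩
    have hKY : K ⊆ Y := hKW.trans (Finset.filter_subset _ _)
    have hlt : (Y \ K).card < m := by
      rw [← hYm]
      apply Finset.card_lt_card
      refine ⟨Finset.sdiff_subset, fun h => ?_⟩
      obtain ⟨w, hw⟩ := hKne
      exact (Finset.mem_sdiff.1 (h (hKY hw))).2 hw
    obtain ⟨f, hf1, hf2⟩ := ih _ hlt (Y \ K) rfl (Finset.sdiff_subset.trans hYX)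
      (fun v => (L v).erase q) (by
        intro v hv
        obtain ⟨hvY, hvK⟩ := Finset.mem_sdiff.1 hv
        have hsub : (Y \ K).filter (fun w => arc v w) ⊆ Y.filter (fun w => arc v w) :=
          Finset.filter_subset_filter _ Finset.sdiff_subset
        by_cases hqv : q ∈ L v
        · obtain ⟨w, hw, hvw⟩ := hKa v (Finset.mem_filter.2 ⟨hvY, hqv⟩) hvK
          have : ((Y \ K).filter (fun w => arc v w)).card < (Y.filter (fun w => arc v w)).card := by
            apply Finset.card_lt_card
            refine ⟨hsub, fun h => ?_⟩
            have := h (Finset.mem_filter.2 ⟨hKY hw, hvw⟩)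
            simp only [Finset.mem_filter, Finset.mem_sdiff] at this
            exact this.1.2 hw
          have h1 := hL v hvY
          show _ < ((L v).erase q).card
          rw [Finset.card_erase_of_mem hqv]
          omega
        · show _ < ((L v).erase q).card
          rw [Finset.erase_eq_of_notMem hqv]
          exact lt_of_le_of_lt (Finset.card_le_card hsub) (hL v hvY))
    refine ⟨fun v => if v ∈ K then q else f v, ?_, ?_⟩
    · intro v hv
      by_cases hvK : v ∈ K
      · simp only [hvK, if_true]
        exact (Finset.mem_filter.1 (hKW hvK)).2
      · simp only [hvK, if_false]
        exact Finset.mem_of_mem_erase (hf1 v (Finset.mem_sdiff.2 ⟨hv, hvK⟩))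
    · intro v hv w hw hvw
      by_cases hvK : v ∈ K <;> by_cases hwK : w ∈ K
      · exact absurd hvw (hKi v hvK w hwK)
      · simp only [hvK, hwK, if_true, if_false]
        exact (Finset.ne_of_mem_erase (hf1 w (Finset.mem_sdiff.2 ⟨hw, hwK⟩))).symm
      · simp only [hvK, hwK, if_true, if_false]
        exact Finset.ne_of_mem_erase (hf1 v (Finset.mem_sdiff.2 ⟨hv, hvK⟩))
      · simp only [hvK, hwK, if_false]
        exact hf2 v (Finset.mem_sdiff.2 ⟨hv, hvK⟩) w (Finset.mem_sdiff.2 ⟨hw, hwK⟩) hvw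

/-- Kernels in the auxiliary digraph. -/
lemma kernel_exists {β : Type*} (n : ℕ) (σ : ℕ → β) (key : ℕ → ℕ)
    (hkey : ∀ i < n, ∀ j < n, key i = key j → i = j)
    (carc : ℕ → ℕ → Prop)
    (hirr : ∀ a < n, ¬ carc a a)
    (hstep : ∀ v < n, ∀ a < n, ∀ b < n, carc v a → carc a b → carc v b)
    (W : Finset ℕ) (hW : W ⊆ Finset.range n) :
    ∃ K ⊆ W, (∀ a ∈ K, ∀ b ∈ K, ¬ ((σ a = σ b ∧ key b < key a) ∨ carc a b)) ∧
      ∀ v ∈ W, v ∉ K → ∃ w ∈ K, (σ v = σ w ∧ key w < key v) ∨ carc v w := by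
  let cand : Finset ℕ → ℕ → Prop := fun R t =>
    t ∈ W ∧ t ∉ R ∧ ∀ w ∈ W, σ w = σ t → w ∉ R → key t ≤ key w
  let good : Finset ℕ → Prop := fun R => ∀ v ∈ R, ∃ t, cand R t ∧ carc v t
  obtain ⟨R, hR, hRmax⟩ := Finset.exists_max_image (W.powerset.filter good) Finset.card
    ⟨∅, by simp [good]⟩
  simp only [Finset.mem_filter, Finset.mem_powerset] at hR hRmax
  obtain ⟨hRW, hRg⟩ := hR
  refine ⟨W.filter (cand R), Finset.filter_subset _ _, ?_, ?_⟩
  · intro a ha b hb hab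
    have haW := (Finset.mem_filter.1 ha).1
    have hbW := (Finset.mem_filter.1 hb).1
    have ha := (Finset.mem_filter.1 ha).2
    have hb := (Finset.mem_filter.1 hb).2
    have han := Finset.mem_range.1 (hW haW)
    have hbn := Finset.mem_range.1 (hW hbW)
    rcases hab with ⟨h1, h2⟩ | hab
    · have := ha.2.2 b hbW h1.symm hb.2.1
      omega
    · have hne : b ≠ a := by
        rintro rfl
        exact hirr _ han hab
      have hmono : ∀ t, t ≠ a → cand R t → cand (insert a R) t := by
        intro t hta ht
        refine ⟨ht.1, ?_, ?_⟩
        · simp [hta, ht.2.1]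
        · intro w hw hwt hwR
          exact ht.2.2 w hw hwt (fun h => hwR (Finset.mem_insert_of_mem h))
      have hgood : good (insert a R) := by
        intro v hv
        rcases Finset.mem_insert.1 hv with rfl | hvR
        · exact ⟨b, hmono b hne hb, hab⟩
        · obtain ⟨t, ht, hvt⟩ := hRg v hvR
          by_cases hta : t = a
          · subst hta
            exact ⟨b, hmono b hne hb,
              hstep v (Finset.mem_range.1 (hW (hRW hvR))) t han b hbn hvt hab⟩
          · exact ⟨t, hmono t hta ht, hvt⟩
      have := hRmax (insert a R) ⟨Finset.insert_subset haW hRW, hgood⟩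
      rw [Finset.card_insert_of_notMem ha.2.1] at this
      omega
  · intro v hv hvK
    by_cases hvR : v ∈ R
    · obtain ⟨t, ht, hvt⟩ := hRg v hvR
      exact ⟨t, Finset.mem_filter.2 ⟨ht.1, ht⟩, Or.inr hvt⟩
    · obtain ⟨t, ht, htmin⟩ := Finset.exists_min_image
        (W.filter (fun w => σ w = σ v ∧ w ∉ R)) key ⟨v, by simp [hv, hvR]⟩
      simp only [Finset.mem_filter] at ht htmin
      have hc : cand R t := ⟨ht.1, ht.2.2, fun w hw hwt hwR =>
        htmin w ⟨hw, hwt.trans ht.2.1, hwR⟩⟩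
      have htK : t ∈ W.filter (cand R) := Finset.mem_filter.2 ⟨ht.1, hc⟩
      refine ⟨t, htK, Or.inl ⟨ht.2.1.symm, ?_⟩⟩
      have h1 := htmin v ⟨hv, rfl, hvR⟩
      have h2 : key t ≠ key v := by
        intro h
        have := hkey t (Finset.mem_range.1 (hW ht.1)) v (Finset.mem_range.1 (hW hv)) h
        exact hvK (this ▸ htK)
      omega

/-- Stage 2: list colouring of a union of cliques (the stars) and a cycle. -/
lemma stage_two {β : Type*} (n : ℕ) (hn : 3 ≤ n) (N : ℕ) (hN : 10 ≤ N) (σ : ℕ → β)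
    (hσ : ∀ u, ((Finset.range n).filter (fun j => σ j = u)).card ≤ N)
    (L : ℕ → Finset ℕ) (hL : ∀ j < n, N ≤ (L j).card) :
    ∃ l : ℕ → ℕ, (∀ j < n, l j ∈ L j) ∧
      (∀ i < n, ∀ j < n, i ≠ j → σ i = σ j → l i ≠ l j) ∧
      (∀ j, j + 1 < n → l j ≠ l (j + 1)) ∧ l (n - 1) ≠ l 0 := by
  obtain ⟨Y1, hY1X, hY1c, hY1σ⟩ := halving (Finset.range (n - 1)) (fun j => j / 2) σ (by
    intro a
    calc _ ≤ ({2 * a, 2 * a + 1} : Finset ℕ).card := Finset.card_le_card (by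
          intro x hx
          simp only [Finset.mem_filter] at hx
          simp only [Finset.mem_insert, Finset.mem_singleton]
          omega)
      _ ≤ 2 := Finset.card_le_two)
  obtain ⟨Y2, hY2X, hY2c, hY2σ⟩ := halving Y1 (fun j => (j + 1) / 2) σ (by
    intro a
    calc _ ≤ ({2 * a - 1, 2 * a} : Finset ℕ).card := Finset.card_le_card (by
          intro x hx
          simp only [Finset.mem_filter] at hx
          simp only [Finset.mem_insert, Finset.mem_singleton]
          omega)
      _ ≤ 2 := Finset.card_le_two)
  let nx : ℕ → ℕ := fun j => if j + 1 = n then 0 else j + 1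
  let pv : ℕ → ℕ := fun j => if j = 0 then n - 1 else j - 1
  have hnx : ∀ j < n, nx j < n := by intro j hj; simp only [nx]; split_ifs <;> omega
  have hpv : ∀ j < n, pv j < n := by intro j hj; simp only [pv]; split_ifs <;> omega
  have hnp : ∀ j < n, nx (pv j) = j := by
    intro j hj
    by_cases h0 : j = 0
    · have : pv j = n - 1 := if_pos h0
      rw [this]
      exact (if_pos (by omega)).trans h0.symm
    · have : pv j = j - 1 := if_neg h0
      rw [this]
      exact (if_neg (by omega)).trans (by omega)
  have hpn : ∀ j < n, pv (nx j) = j := by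
    intro j hj
    by_cases h0 : j + 1 = n
    · have : nx j = 0 := if_pos h0
      rw [this]
      exact (if_pos rfl).trans (by omega)
    · have : nx j = j + 1 := if_neg h0
      rw [this]
      exact (if_neg (by omega)).trans (by omega)
  have hn1 : ∀ j < n, nx j ≠ j := by intro j hj; simp only [nx]; split_ifs <;> omega
  have hn2 : ∀ j < n, nx (nx j) ≠ j := by intro j hj; simp only [nx]; split_ifs <;> omega
  have hY2n : ∀ j ∈ Y2, j < n - 1 := fun j hj => Finset.mem_range.1 (hY1X (hY2X hj))
  have hY2i : ∀ j ∈ Y2, nx j ∉ Y2 := by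
    intro j hj hj'
    have h1 := hY2n j hj
    have h2 : nx j = j + 1 := by simp only [nx]; rw [if_neg (by omega)]
    rw [h2] at hj'
    rcases Nat.even_or_odd' j with ⟨a, ha | ha⟩
    · have := hY1c j (hY2X hj) (j + 1) (hY2X hj') (by show j / 2 = (j + 1) / 2; omega)
      omega
    · have := hY2c j hj (j + 1) hj' (by show (j + 1) / 2 = (j + 1 + 1) / 2; omega)
      omega
  obtain ⟨I, hI, hImax⟩ := Finset.exists_max_image
    ((Finset.range n).powerset.filter (fun I => Y2 ⊆ I ∧ ∀ j ∈ I, nx j ∉ I)) Finset.card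
    ⟨Y2, by
      simp only [Finset.mem_filter, Finset.mem_powerset]
      refine ⟨?_, Finset.Subset.refl _, hY2i⟩
      intro j hj
      have := hY2n j hj
      exact Finset.mem_range.2 (by omega)⟩
  simp only [Finset.mem_filter, Finset.mem_powerset] at hI hImax
  obtain ⟨hIn, hYI, hIi⟩ := hI
  have hIn' : ∀ j ∈ I, j < n := fun j hj => Finset.mem_range.1 (hIn hj)
  have hmax : ∀ q < n, q ∉ I → nx q ∈ I ∨ pv q ∈ I := by
    intro q hq hqI
    by_contra hcon
    push Not at hcon
    have := hImax (insert q I) ⟨Finset.insert_subset (Finset.mem_range.2 hq) hIn,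
      hYI.trans (Finset.subset_insert _ _), by
        intro j hj hj'
        rcases Finset.mem_insert.1 hj with rfl | hj <;> rcases Finset.mem_insert.1 hj' with h' | hj'
        · exact hn1 _ hq h'
        · exact hcon.1 hj'
        · apply hcon.2
          rw [← h', hpn j (hIn' j hj)]
          exact hj
        · exact hIi j hj hj'⟩
    rw [Finset.card_insert_of_notMem hqI] at this
    omega
  let Q := Finset.range n \ I
  have hQ : ∀ q, q ∈ Q ↔ q < n ∧ q ∉ I := by intro q; simp [Q]
  obtain ⟨Y3, hY3Q, hY3c, hY3σ⟩ := halving Q (fun q => if pv q ∈ Q then pv q else q) σ (by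
    intro a
    calc _ ≤ ({a, nx a} : Finset ℕ).card := Finset.card_le_card (by
          intro x hx
          simp only [Finset.mem_filter] at hx
          simp only [Finset.mem_insert, Finset.mem_singleton]
          obtain ⟨hxQ, hx⟩ := hx
          split_ifs at hx with hp
          · right
            rw [← hx, hnp x ((hQ x).1 hxQ).1]
          · left; exact hx)
      _ ≤ 2 := Finset.card_le_two)
  let hv : ℕ → ℕ → Prop := fun q q' => q ∈ Q ∧ q' ∈ Q ∧ q ∉ Y3 ∧
    (nx q = q' ∨ (nx q' = q ∧ q' ∈ Y3))
  have hvanti : ∀ a b, hv a b → ¬ hv b a := by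
    rintro a b ⟨ha, hb, ha3, h | ⟨_, h⟩⟩ ⟨_, _, hb3, h' | ⟨_, h'⟩⟩
    · exact hn2 a ((hQ a).1 ha).1 (by rw [h, h'])
    · exact ha3 h'
    · exact hb3 h
    · exact hb3 h
  have hvuniq : ∀ a b c, (hv a b ∨ hv b a) → (hv a c ∨ hv c a) → b = c := by
    intro a b c hab hac
    have key : ∀ b, (hv a b ∨ hv b a) → a ∈ Q ∧ b ∈ Q ∧ (nx a = b ∨ pv a = b) := by
      rintro b (⟨h1, h2, _, h | ⟨h, _⟩⟩ | ⟨h1, h2, _, h | ⟨h, _⟩⟩)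
      · exact ⟨h1, h2, Or.inl h⟩
      · exact ⟨h1, h2, Or.inr (by rw [← h, hpn b ((hQ b).1 h2).1])⟩
      · exact ⟨h2, h1, Or.inr (by rw [← h, hpn b ((hQ b).1 h1).1])⟩
      · exact ⟨h2, h1, Or.inl h⟩
    obtain ⟨h1, h2, h3⟩ := key b hab
    obtain ⟨_, h5, h6⟩ := key c hac
    have hm := hmax a ((hQ a).1 h1).1 ((hQ a).1 h1).2
    have hb := ((hQ b).1 h2).2
    have hc := ((hQ c).1 h5).2
    rcases h3 with rfl | rfl <;> rcases h6 with rfl | rfl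
    · rfl
    · tauto
    · tauto
    · rfl
  let carc : ℕ → ℕ → Prop := fun v w =>
    (v ∈ Q ∧ w ∈ I ∧ (nx v = w ∨ pv v = w)) ∨ hv v w ∨
    (w ∈ I ∧ ∃ q, hv v q ∧ (nx q = w ∨ pv q = w))
  have hcQ : ∀ v w, carc v w → v ∈ Q := by
    rintro v w (h | h | ⟨_, q, h, _⟩)
    · exact h.1
    · exact h.1
    · exact h.1
  let heavy : ℕ → Prop := fun v => ∃ q, hv v q
  let key : ℕ → ℕ := fun v => (if v ∈ I then 2 else if heavy v then 0 else 1) * n + v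
  have hQI : ∀ v ∈ Q, v ∉ I := fun v hv => ((hQ v).1 hv).2
  have hker := kernel_exists n σ key (by
      intro i hi j hj hij
      simp only [key] at hij
      split_ifs at hij <;> omega) carc (by
      rintro a ha (⟨h1, h2, _⟩ | h | ⟨h1, q, h, _⟩)
      · exact hQI a h1 h2
      · exact hvanti a a h h
      · exact hQI a h.1 h1) (by
      intro v _ a _ b _ hva hab
      have haQ := hcQ _ _ hab
      have hva' : hv v a := by
        rcases hva with ⟨_, h, _⟩ | h | ⟨h, _⟩
        · exact absurd h (hQI a haQ)
        · exact h
        · exact absurd h (hQI a haQ)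
      rcases hab with ⟨_, h1, h2⟩ | h | ⟨h1, q, h, _⟩
      · exact Or.inr (Or.inr ⟨h1, a, hva', h2⟩)
      · have := hvuniq a b v (Or.inl h) (Or.inr hva')
        subst this
        exact absurd h (hvanti _ _ hva')
      · have := hvuniq a q v (Or.inl h) (Or.inr hva')
        subst this
        exact absurd h (hvanti _ _ hva'))
  have hstar : ∀ v < n, ((Finset.range n).filter (fun w => σ v = σ w ∧ key w < key v)).card +
      (if v ∈ I then 0 else if heavy v then 3 else 2) < N := by
    intro v hvn
    have hS := hσ (σ v)
    set St := (Finset.range n).filter (fun j => σ j = σ v) with hSt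
    set s := (I.filter (fun j => σ j = σ v)).card with hs
    set y := (Y3.filter (fun j => σ j = σ v)).card with hy
    have e1 : St.card - 1 ≤ ((Finset.range (n-1)).filter (fun j => σ j = σ v)).card := by
      have : St ⊆ insert (n-1) ((Finset.range (n-1)).filter (fun j => σ j = σ v)) := by
        intro j hj
        simp only [hSt, Finset.mem_filter, Finset.mem_range] at hj
        simp only [Finset.mem_insert, Finset.mem_filter, Finset.mem_range]
        by_cases h : j = n - 1
        · exact Or.inl h
        · exact Or.inr ⟨by omega, hj.2⟩
      have := (Finset.card_le_card this).trans (Finset.card_insert_le _ _)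
      omega
    have e2 := hY1σ (σ v)
    have e3 := hY2σ (σ v)
    have e4 : (Y2.filter (fun j => σ j = σ v)).card ≤ s :=
      Finset.card_le_card (Finset.filter_subset_filter _ hYI)
    have e5 := hY3σ (σ v)
    have e6 : (Q.filter (fun j => σ j = σ v)).card + s = St.card := by
      rw [hs, ← Finset.card_union_of_disjoint]
      · congr 1
        ext j
        simp only [hSt, Finset.mem_union, Finset.mem_filter, hQ, Finset.mem_range]
        have := hIn' j
        tauto
      · rw [Finset.disjoint_left]
        intro j hj hj'
        simp only [Finset.mem_filter, hQ] at hj hj'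
        exact hj.1.2 hj'.1
    have hvS : v ∈ St := by simp [hSt, hvn]
    have hheavyY : ∀ j ∈ Y3, ¬ heavy j := by
      rintro j hj ⟨q, hq⟩
      exact hq.2.2.1 hj
    have o1 : ((Finset.range n).filter (fun w => σ v = σ w ∧ key w < key v)).card + 1 ≤ St.card := by
      rw [← Finset.card_erase_add_one hvS]
      apply Nat.succ_le_succ
      apply Finset.card_le_card
      intro w hw
      simp only [Finset.mem_filter, Finset.mem_range] at hw
      simp only [hSt, Finset.mem_erase, Finset.mem_filter, Finset.mem_range]
      refine ⟨?_, hw.1, hw.2.1.symm⟩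
      rintro rfl
      exact lt_irrefl _ hw.2.2
    have o2 : v ∉ I → ((Finset.range n).filter (fun w => σ v = σ w ∧ key w < key v)).card + 1 + s
        ≤ St.card := by
      intro hvI
      have hvQ : v ∈ Q.filter (fun j => σ j = σ v) := by simp [hQ, hvn, hvI]
      rw [← e6, ← Finset.card_erase_add_one hvQ]
      apply Nat.add_le_add_right
      apply Nat.succ_le_succ
      apply Finset.card_le_card
      intro w hw
      simp only [Finset.mem_filter, Finset.mem_range] at hw
      simp only [Finset.mem_erase, Finset.mem_filter, hQ]
      refine ⟨?_, ⟨hw.1, ?_⟩, hw.2.1.symm⟩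
      · rintro rfl
        exact lt_irrefl _ hw.2.2
      · intro hwI
        have := hw.2.2
        simp only [key, hwI, hvI, if_true, if_false] at this
        split_ifs at this <;> omega
    have o3 : v ∉ I → heavy v →
        ((Finset.range n).filter (fun w => σ v = σ w ∧ key w < key v)).card + 1 + s + y
        ≤ St.card := by
      intro hvI hvh
      have hd : ((Finset.range n).filter (fun w => σ v = σ w ∧ key w < key v)).card + 1 + y
          ≤ (Q.filter (fun j => σ j = σ v)).card := by
        have hvm : v ∉ (Finset.range n).filter (fun w => σ v = σ w ∧ key w < key v) := by simp
        rw [← Finset.card_insert_of_notMem hvm, hy, ← Finset.card_union_of_disjoint]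
        · apply Finset.card_le_card
          intro w hw
          rcases Finset.mem_union.1 hw with hw | hw
          · rcases Finset.mem_insert.1 hw with rfl | hw
            · simp [hQ, hvn, hvI]
            · simp only [Finset.mem_filter, Finset.mem_range] at hw
              simp only [Finset.mem_filter, hQ]
              refine ⟨⟨hw.1, ?_⟩, hw.2.1.symm⟩
              intro hwI
              have := hw.2.2
              simp only [key, hwI, hvI, if_true, if_false] at this
              split_ifs at this <;> omega
          · exact Finset.filter_subset_filter _ hY3Q hw
        · rw [Finset.disjoint_left]
          intro w hw hw'
          simp only [Finset.mem_filter] at hw'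
          have hwh := hheavyY w hw'.1
          have hwI := hQI w (hY3Q hw'.1)
          rcases Finset.mem_insert.1 hw with rfl | hw
          · exact hwh hvh
          · have := (Finset.mem_filter.1 hw).2.2
            simp only [key, hwI, hvI, hwh, hvh, if_true, if_false] at this
            omega
      omega
    by_cases hvI : v ∈ I
    · simp only [hvI, if_true]; omega
    · have := o2 hvI
      by_cases hvh : heavy v
      · have := o3 hvI hvh
        simp only [hvI, hvh, if_true, if_false]; omega
      · simp only [hvI, hvh, if_false]; omega
  have hcarc : ∀ v < n, ((Finset.range n).filter (fun w => carc v w)).card ≤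
      (if v ∈ I then 0 else if heavy v then 3 else 2) := by
    intro v hvn
    by_cases hvI : v ∈ I
    · simp only [hvI, if_true, Nat.le_zero, Finset.card_eq_zero]
      apply Finset.filter_eq_empty_iff.2
      intro w _ hw
      exact hQI v (hcQ v w hw) hvI
    by_cases hvh : heavy v
    · simp only [hvI, hvh, if_true, if_false]
      obtain ⟨q, hq⟩ := hvh
      refine le_trans (Finset.card_le_card (t := {nx v, pv v, if nx v = q then nx q else pv q}) ?_)
        Finset.card_le_three
      intro w hw
      simp only [Finset.mem_filter] at hw
      simp only [Finset.mem_insert, Finset.mem_singleton]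
      rcases hw.2 with ⟨_, _, h | h⟩ | h | ⟨hwI, q', hq', h⟩
      · exact Or.inl h.symm
      · exact Or.inr (Or.inl h.symm)
      · rcases h.2.2.2 with h' | ⟨h', _⟩
        · exact Or.inl h'.symm
        · right; left
          rw [← h', hpn w (Finset.mem_range.1 hw.1)]
      · have := hvuniq v q' q (Or.inl hq') (Or.inl hq)
        subst this
        right; right
        rcases hq'.2.2.2 with h' | ⟨h', _⟩
        · rw [if_pos h']
          rcases h with h | h
          · exact h.symm
          · rw [← h', hpn v hvn] at h
            exact absurd (h ▸ hwI) hvI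
        · rcases h with h | h
          · rw [h'] at h
            exact absurd (h ▸ hwI) hvI
          · rw [if_neg]
            · exact h.symm
            · intro h2
              exact hn2 v hvn (by rw [h2, h'])
    · simp only [hvI, hvh, if_false]
      refine le_trans (Finset.card_le_card (t := {nx v, pv v}) ?_) Finset.card_le_two
      intro w hw
      simp only [Finset.mem_filter] at hw
      simp only [Finset.mem_insert, Finset.mem_singleton]
      rcases hw.2 with ⟨_, _, h | h⟩ | h | ⟨hwI, q', hq', h⟩
      · exact Or.inl h.symm
      · exact Or.inr h.symm
      · exact absurd ⟨w, h⟩ hvh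
      · exact absurd ⟨q', hq'⟩ hvh
  obtain ⟨R, hR⟩ : ∃ R : ℕ → ℕ → Prop,
    R = (fun v w => (σ v = σ w ∧ key w < key v) ∨ carc v w) := ⟨_, rfl⟩
  have hR' : ∀ v w, R v w ↔ ((σ v = σ w ∧ key w < key v) ∨ carc v w) := by
    intro v w; rw [hR]
  obtain ⟨f, hf1, hf2⟩ := kernel_color
    R (Finset.range n) (by rw [hR]; exact hker) n (Finset.range n)
    (by simp) (Finset.Subset.refl _) L (by
      intro v hv
      have hvn := Finset.mem_range.1 hv
      have h1 := hstar v hvn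
      have h2 := hcarc v hvn
      have h3 := hL v hvn
      refine lt_of_le_of_lt (Finset.card_le_card (t := (Finset.range n).filter (fun w => σ v = σ w ∧ key w < key v) ∪
          (Finset.range n).filter (fun w => carc v w)) (by
          intro w hw
          rw [Finset.mem_filter] at hw
          rcases (hR' _ _).1 hw.2 with h | h
          · exact Finset.mem_union_left _ (Finset.mem_filter.2 ⟨hw.1, h⟩)
          · exact Finset.mem_union_right _ (Finset.mem_filter.2 ⟨hw.1, h⟩))) ?_
      have h4 := Finset.card_union_le ((Finset.range n).filter (fun w => σ v = σ w ∧ key w < key v))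
        ((Finset.range n).filter (fun w => carc v w))
      omega)
  simp only [hR'] at hf2
  have hcyc : ∀ a < n, f a ≠ f (nx a) := by
    intro a ha
    have ha' := hnx a ha
    have hfa : carc a (nx a) → f a ≠ f (nx a) := fun h =>
      hf2 a (Finset.mem_range.2 ha) (nx a) (Finset.mem_range.2 ha') (Or.inr h)
    have hfb : carc (nx a) a → f a ≠ f (nx a) := fun h =>
      (hf2 (nx a) (Finset.mem_range.2 ha') a (Finset.mem_range.2 ha) (Or.inr h)).symm
    by_cases h1 : a ∈ I
    · have h2 := hIi a h1
      exact hfb (Or.inl ⟨(hQ _).2 ⟨ha', h2⟩, h1, Or.inr (hpn a ha)⟩)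
    · have haQ := (hQ a).2 ⟨ha, h1⟩
      by_cases h2 : nx a ∈ I
      · exact hfa (Or.inl ⟨haQ, h2, Or.inl rfl⟩)
      · have hbQ := (hQ (nx a)).2 ⟨ha', h2⟩
        by_cases h3 : a ∈ Y3
        · apply hfb
          refine Or.inr (Or.inl ⟨hbQ, haQ, ?_, Or.inr ⟨rfl, h3⟩⟩)
          intro h4
          have hpa : pv a ∉ Q := by
            rcases hmax a ha h1 with h | h
            · exact absurd h h2
            · exact fun h' => hQI _ h' h
          have := hY3c a h3 (nx a) h4 (by
            show (if pv a ∈ Q then pv a else a) = (if pv (nx a) ∈ Q then pv (nx a) else nx a)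
            rw [if_neg hpa, hpn a ha, if_pos haQ])
          exact hn1 a ha this.symm
        · exact hfa (Or.inr (Or.inl ⟨haQ, hbQ, h3, Or.inl rfl⟩))
  refine ⟨f, fun j hj => hf1 j (Finset.mem_range.2 hj), ?_, ?_, ?_⟩
  · intro i hi j hj hij hs
    have hk : key i ≠ key j := by
      intro h
      simp only [key] at h
      split_ifs at h <;> omega
    rcases lt_or_gt_of_ne hk with h | h
    · exact (hf2 j (Finset.mem_range.2 hj) i (Finset.mem_range.2 hi) (Or.inl ⟨hs.symm, h⟩)).symm
    · exact hf2 i (Finset.mem_range.2 hi) j (Finset.mem_range.2 hj) (Or.inl ⟨hs, h⟩)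
  · intro j hj
    have := hcyc j (by omega)
    simpa only [nx, if_neg (show ¬ j + 1 = n by omega)] using this
  · have := hcyc (n - 1) (by omega)
    simpa only [nx, if_pos (show n - 1 + 1 = n by omega)] using this

/-- Hall theorem relative to a finset of indices. -/
lemma hall_on {α β : Type*} [Nonempty β] [DecidableEq β] (s : Finset α) (t : α → Finset β)
    (h : ∀ S ⊆ s, S.card ≤ (S.biUnion t).card) :
    ∃ f : α → β, (∀ x ∈ s, f x ∈ t x) ∧ ∀ x ∈ s, ∀ y ∈ s, f x = f y → x = y := by
  obtain ⟨f, hf, hfm⟩ := (Finset.all_card_le_biUnion_card_iff_exists_injective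
    (fun x : s => t x.1)).1 (by
      intro S
      have h1 := h (S.map (Function.Embedding.subtype _)) (by
        intro x hx
        simp only [Finset.mem_map, Function.Embedding.subtype_apply] at hx
        obtain ⟨a, _, rfl⟩ := hx
        exact a.2)
      rw [Finset.card_map] at h1
      refine h1.trans (Finset.card_le_card ?_)
      intro p hp
      simp only [Finset.mem_biUnion, Finset.mem_map, Function.Embedding.subtype_apply] at hp ⊢
      obtain ⟨_, ⟨a, ha, rfl⟩, hp⟩ := hp
      exact ⟨a, ha, hp⟩)
  refine ⟨fun x => if hx : x ∈ s then f ⟨x, hx⟩ else Classical.arbitrary β, ?_, ?_⟩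
  · intro x hx
    simp only [hx, dif_pos]
    exact hfm ⟨x, hx⟩
  · intro x hx y hy
    simp only [hx, hy, dif_pos]
    intro h
    exact congrArg Subtype.val (hf h)

/-- The arithmetic at the heart of the Hall condition. -/
lemma tour_arith (h m q t y b δ e n1 cq ch : ℕ) (hh : 5 ≤ h) (hmq : m + q = 2 * h)
    (ht : t ≤ m) (hth : t ≤ h) (htq : h ≤ t + q) (hyq : y ≤ q) (hby : y + t + m ≤ b + h + 2 * t)
    (hδ : δ ≤ 1) (hδb : δ ≤ b) (hb : b ≤ y)
    (hcq : 2 * cq + q = q * q) (hch : 2 * ch + 2 * h = (2 * h) * (2 * h)) (hn1 : n1 + cq = ch)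
    (he0 : m = 0 → 2 * y + b ≤ 2 * e) (he1 : m = 1 → y + b ≤ 2 * e) (he2 : m = 2 → b ≤ 2 * e) :
    m * h + y + δ ≤ n1 + e + t := by
  have key : 2 * n1 = m * (2 * h) + m * (q - 1) ∨ q = 0 := by
    rcases Nat.eq_zero_or_pos q with hq | hq
    · exact Or.inr hq
    · left
      obtain ⟨p, rfl⟩ : ∃ p, q = p + 1 := ⟨q - 1, by omega⟩
      simp only [Nat.add_sub_cancel]
      have h2 : 2 * h = m + (p + 1) := hmq.symm
      rw [h2] at hch ⊢
      nlinarith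
  have hmh : m * (2 * h) = 2 * (m * h) := by ring
  rcases key with key | hq
  · rw [hmh] at key
    generalize hP : m * h = P at *
    rcases Nat.lt_or_ge m 3 with hm | hm
    · have hm3 : m = 0 ∨ m = 1 ∨ m = 2 := by omega
      rcases hm3 with rfl | rfl | rfl
      · have := he0 rfl
        omega
      · have := he1 rfl
        omega
      · have := he2 rfl
        omega
    · clear hP hmh hch hcq he0 he1 he2
      rcases Nat.lt_or_ge q 5 with hq | hq
      · have hq5 : q = 0 ∨ q = 1 ∨ q = 2 ∨ q = 3 ∨ q = 4 := by omega
        rcases hq5 with rfl | rfl | rfl | rfl | rfl <;> omega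
      · have : 2 * q + 2 ≤ m * (q - 1) := by
          obtain ⟨p, rfl⟩ : ∃ p, q = p + 5 := ⟨q - 5, by omega⟩
          obtain ⟨a, rfl⟩ : ∃ a, m = a + 3 := ⟨m - 3, by omega⟩
          have e1 : p + 5 - 1 = p + 4 := by omega
          rw [e1]
          nlinarith [Nat.zero_le (a * p)]
        omega
  · subst hq
    have : m = 2 * h := by omega
    subst this
    have e2 : 2 * h * h * 2 = 2 * h * (2 * h) := by ring
    omega

lemma pair_eq_cases {a b x z : ℕ} (h : ({a, b} : Finset ℕ) = {x, z}) (hab : a ≠ b) :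
    (a = x ∧ b = z) ∨ (a = z ∧ b = x) := by
  have ha : a ∈ ({x, z} : Finset ℕ) := h ▸ (by simp)
  have hb : b ∈ ({x, z} : Finset ℕ) := h ▸ (by simp)
  simp only [Finset.mem_insert, Finset.mem_singleton] at ha hb
  omega

/-- Tournament-like orientations with prescribed requests. -/
lemma tour (h : ℕ) (hh : 5 ≤ h) (K B : Finset ℕ) (hK : K.card = 2 * h) (hB : B ⊆ K)
    (hBc : B.card = h) (O : ℕ → Finset ℕ) (hO : ∀ x ∈ K, O x ⊆ K.erase x)
    (hOc : ∀ x ∈ K, 2 + (if x ∈ B then 1 else 0) ≤ (O x).card) (x0 : ℕ) (hx0 : x0 ∈ B)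
    (O2 : Finset ℕ) (hO2s : O2 ⊆ K.erase x0) (hO2c : 3 ≤ O2.card) :
    ∃ out : ℕ → Finset ℕ, (∀ x ∈ K, out x ⊆ K.erase x) ∧
      (∀ x ∈ K, (out x).card + (if x ∈ B then 1 else 0) ≤ h) ∧
      (∀ x ∈ K, ∀ y ∈ K, x ≠ y → y ∈ out x ∨ x ∈ out y) ∧
      (∀ x ∈ K, ∃ z, z ∈ out x ∧ z ∈ O x) ∧ ∃ z, z ∈ out x0 ∧ z ∈ O2 := by
  obtain ⟨d, hd⟩ : ∃ d : ℕ → ℕ, ∀ x, d x + (if x ∈ B then 1 else 0) = h :=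
    ⟨fun x => h - (if x ∈ B then 1 else 0), fun x => by show h - (if x ∈ B then 1 else 0) + _ = h; split_ifs <;> omega⟩
  have hdpos : ∀ x, 4 ≤ d x := by
    intro x; have := hd x; split_ifs at this <;> omega
  let R : ℕ × ℕ → Finset ℕ := fun p =>
    if p.2 = 0 then O p.1 else if p.1 = x0 ∧ p.2 = 1 then O2 else K.erase p.1
  have hRK : ∀ p : ℕ × ℕ, p.1 ∈ K → R p ⊆ K.erase p.1 := by
    intro p hp
    simp only [R]
    split_ifs with h1 h2
    · exact hO _ hp
    · rw [h2.1]; exact hO2s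
    · exact Finset.Subset.refl _
  let tt : ℕ × ℕ → Finset (Finset ℕ) := fun p => (R p).image (fun z => {p.1, z})
  let slots : Finset (ℕ × ℕ) := K.biUnion (fun x => (Finset.range (d x)).image (fun j => (x, j)))
  have hslots : ∀ p, p ∈ slots ↔ p.1 ∈ K ∧ p.2 < d p.1 := by
    rintro ⟨x, j⟩
    simp [slots]
  have hcardfib : ∀ X : Finset ℕ,
      (X.biUnion (fun x => (Finset.range (d x)).image (fun j => (x, j)))).card = ∑ x ∈ X, d x := by
    intro X
    rw [Finset.card_biUnion]
    · apply Finset.sum_congr rfl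
      intro x _
      rw [Finset.card_image_of_injective]
      · simp
      · intro a b hab
        exact (Prod.mk.inj hab).2
    · intro a _ b _ hab
      rw [Function.onFun, Finset.disjoint_left]
      intro p hp hp'
      simp only [Finset.mem_image] at hp hp'
      obtain ⟨j, _, rfl⟩ := hp
      obtain ⟨j', _, h'⟩ := hp'
      exact hab (Prod.mk.inj h').1.symm
  have hsumd : ∀ X : Finset ℕ, ∑ x ∈ X, d x + (X ∩ B).card = X.card * h := by
    intro X
    have : (X ∩ B).card = ∑ x ∈ X, (if x ∈ B then 1 else 0) := by
      rw [← Finset.filter_mem_eq_inter, Finset.card_filter]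
    rw [this, ← Finset.sum_add_distrib, Finset.sum_congr rfl (fun x _ => hd x)]
    simp
  have hch : ∀ n : ℕ, 2 * n.choose 2 + n = n * n := by
    intro n
    rw [Nat.choose_two_right, Nat.mul_div_cancel' (Nat.even_mul_pred_self n).two_dvd]
    rcases n with _ | n
    · rfl
    · simp only [Nat.add_sub_cancel]; ring
  have hall : ∀ S ⊆ slots, S.card ≤ (S.biUnion tt).card := by
    intro S hS
    let X : Finset ℕ := (S.filter (fun p => ¬ p.2 = 0 ∧ ¬ (p.1 = x0 ∧ p.2 = 1))).image Prod.fst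
    have hXK : X ⊆ K := by
      intro x hx
      simp only [X, Finset.mem_image, Finset.mem_filter] at hx
      obtain ⟨p, hp, rfl⟩ := hx
      exact ((hslots p).1 (hS hp.1)).1
    let S1 := S.filter (fun p => p.1 ∈ X)
    let S2 := S.filter (fun p => ¬ p.1 ∈ X)
    have hS12 : S1.card + S2.card = S.card := Finset.card_filter_add_card_filter_not _
    let Y := S2.image Prod.fst
    have hYK : Y ⊆ K := by
      intro x hx
      simp only [Y, S2, Finset.mem_image, Finset.mem_filter] at hx
      obtain ⟨p, hp, rfl⟩ := hx
      exact ((hslots p).1 (hS hp.1)).1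
    have hYX : ∀ x ∈ Y, x ∉ X := by
      intro x hx
      simp only [Y, S2, Finset.mem_image, Finset.mem_filter] at hx
      obtain ⟨p, hp, rfl⟩ := hx
      exact hp.2
    have hS2 : ∀ p ∈ S2, p.2 = 0 ∨ (p.1 = x0 ∧ p.2 = 1) := by
      intro p hp
      simp only [S2, Finset.mem_filter] at hp
      by_contra hcon
      apply hp.2
      simp only [X, Finset.mem_image, Finset.mem_filter]
      exact ⟨p, ⟨hp.1, by tauto⟩, rfl⟩
    obtain ⟨δ, hδ1, hδb, hδc⟩ : ∃ δ, δ ≤ 1 ∧ δ ≤ (Y ∩ B).card ∧ S2.card ≤ Y.card + δ := by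
      by_cases hc : (x0, 1) ∈ S2
      · refine ⟨1, le_rfl, ?_, ?_⟩
        · apply Finset.card_pos.2
          exact ⟨x0, Finset.mem_inter.2 ⟨Finset.mem_image.2 ⟨_, hc, rfl⟩, hx0⟩⟩
        · rw [← Finset.card_erase_add_one hc]
          apply Nat.succ_le_succ
          apply Finset.card_le_card_of_injOn Prod.fst
          · intro p hp
            exact Finset.mem_image_of_mem _ (Finset.mem_of_mem_erase hp)
          · rintro ⟨a, i⟩ hp ⟨b, j⟩ hq hpq
            have hp := Finset.mem_erase.1 (Finset.mem_coe.1 hp)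
            have hq := Finset.mem_erase.1 (Finset.mem_coe.1 hq)
            have h1 := hS2 _ hp.2
            have h2 := hS2 _ hq.2
            have h3 := hp.1
            have h4 := hq.1
            simp only [ne_eq, Prod.mk.injEq] at *
            omega
      · refine ⟨0, by omega, by omega, ?_⟩
        apply Finset.card_le_card_of_injOn Prod.fst
        · intro p hp
          exact Finset.mem_image_of_mem _ hp
        · rintro ⟨a, i⟩ hp ⟨b, j⟩ hq hpq
          have hp := Finset.mem_coe.1 hp
          have hq := Finset.mem_coe.1 hq
          have h1 := hS2 _ hp
          have h2 := hS2 _ hq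
          have h3 : ¬ (a = x0 ∧ i = 1) := by
            rintro ⟨rfl, rfl⟩; exact hc hp
          have h4 : ¬ (b = x0 ∧ j = 1) := by
            rintro ⟨rfl, rfl⟩; exact hc hq
          simp only [Prod.mk.injEq] at *
          omega
    have hS1c : S1.card + (X ∩ B).card ≤ X.card * h := by
      rw [← hsumd X, ← hcardfib X]
      apply Nat.add_le_add_right
      apply Finset.card_le_card
      rintro ⟨x, j⟩ hp
      simp only [S1, Finset.mem_filter] at hp
      have := (hslots _).1 (hS hp.1)
      simp only [Finset.mem_biUnion, Finset.mem_image, Finset.mem_range]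
      exact ⟨x, hp.2, j, this.2, rfl⟩
    let O' : ℕ → Finset ℕ := fun x => if (x, 0) ∈ S then O x else O2
    have hO' : ∀ x ∈ Y, 2 + (if x ∈ B then 1 else 0) ≤ (O' x).card ∧ O' x ⊆ K.erase x ∧
        ∃ p ∈ S, p.1 = x ∧ R p = O' x := by
      intro x hx
      by_cases hc : (x, 0) ∈ S
      · simp only [O', if_pos hc]
        exact ⟨hOc x (hYK hx), hO x (hYK hx), (x, 0), hc, rfl, by simp [R]⟩
      · simp only [O', if_neg hc]
        obtain ⟨⟨a, j⟩, hp, rfl⟩ := Finset.mem_image.1 hx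
        have hpS := (Finset.mem_filter.1 hp).1
        rcases hS2 _ hp with h0 | ⟨h0, h1⟩
        · simp only at h0
          subst h0
          exact absurd hpS hc
        · simp only at h0 h1
          subst h0 h1
          refine ⟨?_, hO2s, (a, 1), hpS, rfl, by simp [R]⟩
          simp only [hx0, if_true]; exact hO2c
    let N1 := Finset.powersetCard 2 K \ Finset.powersetCard 2 (K \ X)
    let N2 := (Y.sigma (fun x => O' x \ X)).image (fun p => ({p.1, p.2} : Finset ℕ))
    have hN1 : N1 ⊆ S.biUnion tt := by
      intro p hp
      simp only [N1, Finset.mem_sdiff, Finset.mem_powersetCard] at hp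
      obtain ⟨⟨hpK, hp2⟩, hp3⟩ := hp
      obtain ⟨a, b, hab, rfl⟩ := Finset.card_eq_two.1 hp2
      have haK : a ∈ K := hpK (by simp)
      have hbK : b ∈ K := hpK (by simp)
      have key : ∀ a b : ℕ, a ≠ b → b ∈ K → a ∈ X → ({a, b} : Finset ℕ) ∈ S.biUnion tt := by
        intro a b hab hbK haX
        simp only [X, Finset.mem_image, Finset.mem_filter] at haX
        obtain ⟨p, ⟨hpS, h1, h2⟩, rfl⟩ := haX
        refine Finset.mem_biUnion.2 ⟨p, hpS, Finset.mem_image.2 ⟨b, ?_, rfl⟩⟩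
        simp only [R, if_neg h1, if_neg h2]
        exact Finset.mem_erase.2 ⟨hab.symm, hbK⟩
      by_cases haX : a ∈ X
      · exact key a b hab hbK haX
      · by_cases hbX : b ∈ X
        · rw [Finset.pair_comm]
          exact key b a hab.symm haK hbX
        · exfalso
          apply hp3
          refine ⟨?_, hp2⟩
          intro z hz
          simp only [Finset.mem_insert, Finset.mem_singleton] at hz
          rcases hz with rfl | rfl
          · exact Finset.mem_sdiff.2 ⟨haK, haX⟩
          · exact Finset.mem_sdiff.2 ⟨hbK, hbX⟩
    have hN2 : N2 ⊆ S.biUnion tt := by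
      intro p hp
      simp only [N2, Finset.mem_image, Finset.mem_sigma, Finset.mem_sdiff] at hp
      obtain ⟨⟨x, z⟩, ⟨hx, hz, _⟩, rfl⟩ := hp
      obtain ⟨_, _, p, hpS, hpx, hpR⟩ := hO' x hx
      refine Finset.mem_biUnion.2 ⟨p, hpS, Finset.mem_image.2 ⟨z, ?_, ?_⟩⟩
      · rw [hpR]; exact hz
      · simp only [hpx]
    have hdisj : Disjoint N1 N2 := by
      rw [Finset.disjoint_left]
      intro p hp hp'
      simp only [N2, Finset.mem_image, Finset.mem_sigma, Finset.mem_sdiff] at hp'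
      obtain ⟨⟨x, z⟩, ⟨hx, hz, hzX⟩, rfl⟩ := hp'
      simp only [N1, Finset.mem_sdiff] at hp
      apply hp.2
      have hzK := Finset.mem_erase.1 ((hO' x hx).2.1 hz)
      simp only at hzK hzX
      rw [Finset.mem_powersetCard]
      refine ⟨?_, Finset.card_pair hzK.1.symm⟩
      intro w hw
      simp only [Finset.mem_insert, Finset.mem_singleton] at hw
      rcases hw with rfl | rfl
      · exact Finset.mem_sdiff.2 ⟨hYK hx, hYX _ hx⟩
      · exact Finset.mem_sdiff.2 ⟨hzK.2, hzX⟩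
    have hNc : N1.card + N2.card ≤ (S.biUnion tt).card := by
      rw [← Finset.card_union_of_disjoint hdisj]
      exact Finset.card_le_card (Finset.union_subset hN1 hN2)
    have hXq : X.card + (K \ X).card = 2 * h := by
      rw [← hK, ← Finset.card_sdiff_add_card_eq_card hXK]; omega
    have hN1c : N1.card + ((K \ X).card).choose 2 = (2 * h).choose 2 := by
      rw [← hK, ← Finset.card_powersetCard 2 K, ← Finset.card_powersetCard 2 (K \ X)]
      exact Finset.card_sdiff_add_card_eq_card
        (Finset.powersetCard_mono Finset.sdiff_subset)
    have hN2c : 2 * Y.card + (Y ∩ B).card ≤ 2 * N2.card + X.card * Y.card := by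
      have h1 : (Y.sigma (fun x => O' x \ X)).card ≤ 2 * N2.card := by
        apply Finset.card_le_mul_card_image
        intro p hp
        obtain ⟨⟨a, b⟩, hab, rfl⟩ := Finset.mem_image.1 hp
        refine le_trans (Finset.card_le_card (t := {⟨a, b⟩, ⟨b, a⟩}) ?_) Finset.card_le_two
        rintro ⟨x, z⟩ hxz
        obtain ⟨hxz, heq⟩ := Finset.mem_filter.1 hxz
        simp only [Finset.mem_sigma, Finset.mem_sdiff] at hxz
        have hne := Finset.mem_erase.1 ((hO' x hxz.1).2.1 hxz.2.1)
        simp only [Finset.mem_insert, Finset.mem_singleton]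
        rcases pair_eq_cases heq hne.1.symm with ⟨rfl, rfl⟩ | ⟨rfl, rfl⟩
        · exact Or.inl rfl
        · exact Or.inr rfl
      rw [Finset.card_sigma] at h1
      have h2 : ∑ x ∈ Y, (2 + (if x ∈ B then 1 else 0)) ≤ ∑ x ∈ Y, ((O' x \ X).card + X.card) := by
        apply Finset.sum_le_sum
        intro x hx
        have h3 := (hO' x hx).1
        have h4 := Finset.le_card_sdiff X (O' x)
        omega
      have h5 : (Y ∩ B).card = ∑ x ∈ Y, (if x ∈ B then 1 else 0) := by
        rw [← Finset.filter_mem_eq_inter, Finset.card_filter]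
      rw [Finset.sum_add_distrib, Finset.sum_add_distrib, ← h5] at h2
      simp only [Finset.sum_const, smul_eq_mul] at h2
      rw [Nat.mul_comm X.card]
      omega
    have hYq : Y.card ≤ (K \ X).card := Finset.card_le_card (fun x hx =>
      Finset.mem_sdiff.2 ⟨hYK hx, hYX x hx⟩)
    have hYB := Finset.card_inter_add_card_sdiff Y B
    have hXB := Finset.card_inter_add_card_sdiff X B
    have hXY : (Y \ B).card + (X \ B).card ≤ h := by
      rw [← Finset.card_union_of_disjoint]
      · have : (K \ B).card = h := by
          have := Finset.card_sdiff_add_card_eq_card hB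
          omega
        rw [← this]
        apply Finset.card_le_card
        intro z hz
        simp only [Finset.mem_union, Finset.mem_sdiff] at hz ⊢
        rcases hz with hz | hz
        · exact ⟨hYK hz.1, hz.2⟩
        · exact ⟨hXK hz.1, hz.2⟩
      · rw [Finset.disjoint_left]
        intro z hz hz'
        exact hYX z (Finset.mem_sdiff.1 hz).1 (Finset.mem_sdiff.1 hz').1
    have hBX : h ≤ (X ∩ B).card + (K \ X).card := by
      have h1 := Finset.card_inter_add_card_sdiff B X
      have h2 : (B \ X).card ≤ (K \ X).card :=
        Finset.card_le_card (Finset.sdiff_subset_sdiff hB (Finset.Subset.refl _))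
      rw [Finset.inter_comm] at h1
      omega
    have hXBh : (X ∩ B).card ≤ h := hBc ▸ Finset.card_le_card Finset.inter_subset_right
    have hfin := tour_arith h X.card (K \ X).card (X ∩ B).card Y.card (Y ∩ B).card δ N2.card
      N1.card (((K \ X).card).choose 2) ((2 * h).choose 2) hh hXq
      (Finset.card_le_card Finset.inter_subset_left) hXBh hBX hYq (by omega) hδ1 hδb
      (Finset.card_le_card Finset.inter_subset_left) (hch _) (hch _) hN1c
      (by intro h0; rw [h0] at hN2c; omega) (by intro h0; rw [h0] at hN2c; omega)
      (by intro h0; rw [h0] at hN2c; omega)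
    omega
  obtain ⟨f, hf1, hf2⟩ := hall_on slots tt hall
  have hslotc : slots.card = (Finset.powersetCard 2 K).card := by
    have h1 := hsumd K
    have h2 := hcardfib K
    have h3 := hch (2 * h)
    rw [Finset.card_powersetCard, hK]
    have h4 : K ∩ B = B := Finset.inter_eq_right.2 hB
    rw [h4, hBc, hK] at h1
    have h5 : 2 * h * (2 * h) = 2 * (2 * h * h) := by ring
    change slots.card = _ at h2
    omega
  have hfK : ∀ p ∈ slots, ∃ z ∈ R p, f p = {p.1, z} := by
    intro p hp
    obtain ⟨z, hz, h⟩ := Finset.mem_image.1 (hf1 p hp)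
    exact ⟨z, hz, h.symm⟩
  have himg : slots.image f = Finset.powersetCard 2 K := by
    apply Finset.eq_of_subset_of_card_le
    · intro q hq
      obtain ⟨p, hp, rfl⟩ := Finset.mem_image.1 hq
      obtain ⟨z, hz, h⟩ := hfK p hp
      have hpK := ((hslots p).1 hp).1
      have := Finset.mem_erase.1 (hRK p hpK hz)
      rw [h, Finset.mem_powersetCard]
      refine ⟨?_, Finset.card_pair this.1.symm⟩
      intro w hw
      simp only [Finset.mem_insert, Finset.mem_singleton] at hw
      rcases hw with rfl | rfl
      · exact hpK
      · exact this.2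
    · rw [Finset.card_image_of_injOn, hslotc]
      intro a ha b hb hab
      exact hf2 a ha b hb hab
  let out : ℕ → Finset ℕ := fun x => (Finset.range (d x)).biUnion (fun j => (f (x, j)).erase x)
  have hmem : ∀ x ∈ K, ∀ j < d x, ∀ z, f (x, j) = {x, z} → z ≠ x → z ∈ out x := by
    intro x hx j hj z hz hzx
    simp only [out, Finset.mem_biUnion, Finset.mem_range]
    exact ⟨j, hj, by rw [hz]; simp [hzx]⟩
  refine ⟨out, ?_, ?_, ?_, ?_, ?_⟩
  · intro x hx z hz
    simp only [out, Finset.mem_biUnion, Finset.mem_range] at hz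
    obtain ⟨j, hj, hz⟩ := hz
    obtain ⟨w, hw, h⟩ := hfK (x, j) ((hslots _).2 ⟨hx, hj⟩)
    rw [h] at hz
    simp only [Finset.mem_erase, Finset.mem_insert, Finset.mem_singleton] at hz
    have : z = w := by tauto
    subst this
    exact hRK (x, j) hx hw
  · intro x hx
    have h1 : (out x).card ≤ (Finset.range (d x)).card * 1 := by
      apply Finset.card_biUnion_le_card_mul
      intro j hj
      obtain ⟨w, hw, h⟩ := hfK (x, j) ((hslots _).2 ⟨hx, Finset.mem_range.1 hj⟩)
      rw [h]
      refine le_trans (Finset.card_le_card (t := {w}) ?_) (by simp)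
      intro z hz
      simp only [Finset.mem_erase, Finset.mem_insert, Finset.mem_singleton] at hz ⊢
      tauto
    have := hd x
    simp only [Finset.card_range] at h1
    omega
  · intro x hx y hy hxy
    have : ({x, y} : Finset ℕ) ∈ slots.image f := by
      rw [himg, Finset.mem_powersetCard]
      refine ⟨?_, Finset.card_pair hxy⟩
      intro w hw
      simp only [Finset.mem_insert, Finset.mem_singleton] at hw
      rcases hw with rfl | rfl
      · exact hx
      · exact hy
    obtain ⟨⟨a, j⟩, hp, hf⟩ := Finset.mem_image.1 this
    obtain ⟨z, hz, h⟩ := hfK _ hp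
    have hs := (hslots _).1 hp
    rw [h] at hf
    rcases pair_eq_cases hf.symm hxy with ⟨h1, h2⟩ | ⟨h1, h2⟩
    · left
      simp only at h1
      subst h1 h2
      exact hmem x hx j hs.2 y h hxy.symm
    · right
      simp only at h2
      subst h1 h2
      exact hmem y hy j hs.2 x h hxy
  · intro x hx
    have h0 : 0 < d x := by have := hdpos x; omega
    obtain ⟨z, hz, h⟩ := hfK (x, 0) ((hslots _).2 ⟨hx, h0⟩)
    have := Finset.mem_erase.1 (hRK (x, 0) hx hz)
    refine ⟨z, hmem x hx 0 h0 z h this.1, ?_⟩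
    simpa [R] using hz
  · have h0 : 1 < d x0 := by have := hdpos x0; omega
    obtain ⟨z, hz, h⟩ := hfK (x0, 1) ((hslots _).2 ⟨hB hx0, h0⟩)
    have := Finset.mem_erase.1 (hRK (x0, 1) (hB hx0) hz)
    refine ⟨z, hmem x0 (hB hx0) 1 h0 z h this.1, ?_⟩
    simpa [R] using hz

lemma three_left (h k : ℕ) (hk : 2 * h + 6 ≤ k) (L G F : Finset ℕ) (hL : k ≤ L.card)
    (hG : G.card ≤ h + 4) (hF : F.card ≤ h)
    (hx : (∃ z ∈ F, z ∉ L \ G) ∨ h + 3 ≤ (L \ G).card) : 3 ≤ (L \ (G ∪ F)).card := by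
  have h1 := Finset.le_card_sdiff G L
  have h0 : L \ (G ∪ F) = (L \ G) \ F := by
    ext w
    simp only [Finset.mem_sdiff, Finset.mem_union]
    tauto
  rw [h0]
  rcases hx with ⟨z, hz, hz'⟩ | hx
  · have h2 : ((L \ G) \ F) = (L \ G) \ (F.erase z) := by
      ext w
      simp only [Finset.mem_sdiff, Finset.mem_erase] at *
      constructor
      · rintro ⟨h1, h2⟩
        exact ⟨h1, fun h => h2 h.2⟩
      · rintro ⟨h1, h2⟩
        refine ⟨h1, fun h => h2 ⟨?_, h⟩⟩
        rintro rfl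
        exact hz' h1
    have h3 := Finset.le_card_sdiff (F.erase z) (L \ G)
    rw [h2]
    have h4 := Finset.card_erase_add_one hz
    omega
  · have h3 := Finset.le_card_sdiff F (L \ G)
    omega

/-- The request sets used in the star lemma. -/
lemma star_request (h : ℕ) (hh : 5 ≤ h) (K : Finset ℕ) (hK : K.card = 2 * h) (κ : ℕ)
    (hκ : κ ∈ K) (D : Finset ℕ) (pc : ℕ) (hpc : pc ∉ K) (β : Prop) :
    ∃ O ⊆ K.erase κ, 2 + (if β then 1 else 0) ≤ O.card ∧
      ∀ F : Finset ℕ, (β → pc ∈ F) → (∃ z, z ∈ F ∧ z ∈ O) →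
        (∃ z ∈ F, z ∉ D) ∨ h + 3 ≤ D.card := by
  have hKe := Finset.card_erase_add_one hκ
  by_cases hc : 2 + (if β then 1 else 0) ≤ ((K.erase κ).filter (fun z => z ∉ D)).card
  · refine ⟨_, Finset.filter_subset _ _, hc, ?_⟩
    rintro F _ ⟨z, hz, hz'⟩
    exact Or.inl ⟨z, hz, (Finset.mem_filter.1 hz').2⟩
  · refine ⟨K.erase κ, Finset.Subset.refl _, by split_ifs <;> omega, ?_⟩
    intro F hF _
    have h1 := Finset.card_filter_add_card_filter_not (s := K.erase κ) (fun z => z ∉ D)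
    have h2 : (K.erase κ).filter (fun z => ¬ z ∉ D) ⊆ D := by
      intro z hz
      have := (Finset.mem_filter.1 hz).2
      tauto
    have h3 := Finset.card_le_card h2
    by_cases hβ : β
    · by_cases hp : pc ∈ D
      · right
        have h4 : insert pc ((K.erase κ).filter (fun z => ¬ z ∉ D)) ⊆ D :=
          Finset.insert_subset hp h2
        have h5 := Finset.card_le_card h4
        rw [Finset.card_insert_of_notMem (by
          intro h; exact hpc (Finset.mem_of_mem_erase (Finset.mem_filter.1 h).1))] at h5
        simp only [hβ, if_true] at hc
        omega
      · exact Or.inl ⟨pc, hF hβ, hp⟩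
    · right
      simp only [hβ, if_false] at hc
      omega

/-- Star lemma. -/
lemma star_lemma {V : Type*} (h k : ℕ) (hh : 5 ≤ h) (hk : 2 * h + 6 ≤ k) (s : Finset V)
    (c : V → ℕ) (hinj : ∀ x ∈ s, ∀ y ∈ s, c x = c y → x = y) (hs : s.card ≤ 2 * h) (pc : ℕ)
    (hpc : ∀ x ∈ s, c x ≠ pc) (B : Finset V) (hB : B ⊆ s) (x0 : V)
    (hBc : B.card ≤ h) (hx0 : x0 ∈ s → (insert x0 B).card ≤ h)
    (L G : V → Finset ℕ) (L2 G2 : Finset ℕ) :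
    ∃ F : V → Finset ℕ, (∀ x ∈ s, (F x).card ≤ h) ∧
      (∀ x ∈ s, ∀ y ∈ s, x ≠ y → c y ∈ F x ∨ c x ∈ F y) ∧
      (∀ x ∈ B, pc ∈ F x) ∧
      (∀ x ∈ s, k ≤ (L x).card → (G x).card ≤ h + 4 → 3 ≤ (L x \ (G x ∪ F x)).card) ∧
      (x0 ∈ s → k ≤ L2.card → G2.card ≤ h + 4 → 3 ≤ (L2 \ (G2 ∪ F x0)).card) := by
  obtain ⟨K0, hK0, hK0c⟩ := Infinite.exists_superset_card_eq (insert pc (s.image c)) (2 * h + 1)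
    ((Finset.card_insert_le _ _).trans (Nat.succ_le_succ (Finset.card_image_le.trans hs)))
  have hpcK0 : pc ∈ K0 := hK0 (Finset.mem_insert_self _ _)
  obtain ⟨K, hKdef⟩ : ∃ K, K = K0.erase pc := ⟨_, rfl⟩
  have hK : K.card = 2 * h := by
    have := Finset.card_erase_add_one hpcK0
    rw [hKdef]; omega
  have hpcK : pc ∉ K := by rw [hKdef]; simp
  have hcK : ∀ x ∈ s, c x ∈ K := by
    intro x hx
    rw [hKdef]
    exact Finset.mem_erase.2 ⟨hpc x hx, hK0 (Finset.mem_insert_of_mem (Finset.mem_image_of_mem _ hx))⟩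
  obtain ⟨B1, hB1s, hBB1, hB1c, hx0B1⟩ : ∃ B1 ⊆ s, B ⊆ B1 ∧ B1.card ≤ h ∧ (x0 ∈ s → x0 ∈ B1) := by
    by_cases hx : x0 ∈ s
    · exact ⟨insert x0 B, Finset.insert_subset hx hB, Finset.subset_insert _ _, hx0 hx,
        fun _ => Finset.mem_insert_self _ _⟩
    · exact ⟨B, hB, Finset.Subset.refl _, hBc, fun h => absurd h hx⟩
  obtain ⟨B', hB1', hB'K, hB'c⟩ := Finset.exists_subsuperset_card_eq (s := B1.image c) (t := K)
    (n := h) (by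
      intro z hz
      obtain ⟨x, hx, rfl⟩ := Finset.mem_image.1 hz
      exact hcK x (hB1s hx)) (Finset.card_image_le.trans hB1c) (by omega)
  -- inverse of the colouring
  obtain ⟨g, hg⟩ : ∃ g : ℕ → Finset ℕ, ∀ x ∈ s, g (c x) = L x \ G x := by
    refine ⟨fun κ => if hκ : ∃ x ∈ s, c x = κ then L hκ.choose \ G hκ.choose else ∅, ?_⟩
    intro x hx
    have hκ : ∃ y ∈ s, c y = c x := ⟨x, hx, rfl⟩
    simp only [dif_pos hκ]
    have := hinj _ hκ.choose_spec.1 x hx hκ.choose_spec.2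
    rw [this]
  have hreq := fun κ : K => star_request h hh K hK κ.1 κ.2 (g κ.1) pc hpcK (κ.1 ∈ B')
  choose O hOs hOc hOF using hreq
  obtain ⟨κ0, hκ0B, hκ0⟩ : ∃ κ0 ∈ B', x0 ∈ s → c x0 = κ0 := by
    by_cases hx : x0 ∈ s
    · exact ⟨c x0, hB1' (Finset.mem_image_of_mem _ (hx0B1 hx)), fun _ => rfl⟩
    · obtain ⟨κ, hκ⟩ : B'.Nonempty := Finset.card_pos.1 (by omega)
      exact ⟨κ, hκ, fun h => absurd h hx⟩
  obtain ⟨O2, hO2s, hO2c, hO2F⟩ := star_request h hh K hK κ0 (hB'K hκ0B) (L2 \ G2) pc hpcK True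
  obtain ⟨out, _, ho2, ho3, ho4, ho5⟩ := tour h hh K B' hK hB'K hB'c
    (fun x => if hx : x ∈ K then O ⟨x, hx⟩ else ∅)
    (by intro x hx; simp only [dif_pos hx]; exact hOs ⟨x, hx⟩)
    (by intro x hx; simp only [dif_pos hx]; convert hOc ⟨x, hx⟩) κ0 hκ0B O2 hO2s
    (by simpa using hO2c)
  let F : V → Finset ℕ := fun x => if c x ∈ B' then insert pc (out (c x)) else out (c x)
  have hFo : ∀ x, out (c x) ⊆ F x := by
    intro x
    simp only [F]
    split_ifs
    · exact Finset.subset_insert _ _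
    · exact Finset.Subset.refl _
  have hFp : ∀ x, c x ∈ B' → pc ∈ F x := by
    intro x hx
    simp only [F, if_pos hx]
    exact Finset.mem_insert_self _ _
  have hFc : ∀ x ∈ s, (F x).card ≤ h := by
    intro x hx
    have := ho2 (c x) (hcK x hx)
    simp only [F]
    split_ifs with hc
    · rw [if_pos hc] at this
      exact (Finset.card_insert_le _ _).trans this
    · rw [if_neg hc] at this
      exact this
  refine ⟨F, hFc, ?_, ?_, ?_, ?_⟩
  · intro x hx y hy hxy
    rcases ho3 (c x) (hcK x hx) (c y) (hcK y hy) (fun h => hxy (hinj x hx y hy h)) with h | h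
    · exact Or.inl (hFo x h)
    · exact Or.inr (hFo y h)
  · intro x hx
    exact hFp x (hB1' (Finset.mem_image_of_mem _ (hBB1 hx)))
  · intro x hx hL hG
    apply three_left h k hk _ _ _ hL hG (hFc x hx)
    rw [← hg x hx]
    apply hOF ⟨c x, hcK x hx⟩ (F x) (hFp x)
    obtain ⟨z, hz, hz'⟩ := ho4 (c x) (hcK x hx)
    rw [dif_pos (hcK x hx)] at hz'
    exact ⟨z, hFo x hz, hz'⟩
  · intro hx hL hG
    apply three_left h k hk _ _ _ hL hG (hFc x0 hx)
    have e := hκ0 hx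
    apply hO2F (F x0) (fun _ => hFp x0 (by rw [e]; exact hκ0B))
    obtain ⟨z, hz, hz'⟩ := ho5
    exact ⟨z, hFo x0 (by rw [e]; exact hz), hz'⟩

lemma circ_lemma {V : Type*} (h : ℕ) (s : Finset V) (hs : s.card ≤ 2 * h + 1) (c : V → ℕ) :
    ∃ F : V → Finset ℕ, (∀ x ∈ s, (F x).card ≤ h) ∧
      (∀ x ∈ s, ∀ y ∈ s, x ≠ y → c y ∈ F x ∨ c x ∈ F y) := by
  have hn := s.card
  obtain ⟨g, hg⟩ : ∃ g : V → ℕ, (∀ x ∈ s, g x < 2 * h + 1) ∧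
      ∀ x ∈ s, ∀ y ∈ s, g x = g y → x = y := by
    have e := s.equivFin
    refine ⟨fun x => if hx : x ∈ s then (e ⟨x, hx⟩).1 else 0, ?_, ?_⟩
    · intro x hx
      simp only [dif_pos hx]
      have := (e ⟨x, hx⟩).2
      omega
    · intro x hx y hy
      simp only [dif_pos hx, dif_pos hy]
      intro h
      have := e.injective (Fin.ext h)
      exact congrArg Subtype.val this
  let rel : V → V → Prop := fun x y => (g x < g y ∧ g y ≤ g x + h) ∨ g y + h + 1 ≤ g x
  refine ⟨fun x => (s.filter (fun y => rel x y)).image c, ?_, ?_⟩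
  · intro x hx
    refine Finset.card_image_le.trans ?_
    have h1 : (s.filter (fun y => rel x y)).card ≤ (Finset.range h).card := by
      apply Finset.card_le_card_of_injOn (fun y => if g x < g y then g y - g x - 1
        else g y + 2 * h - g x)
      · intro y hy
        have hy := Finset.mem_filter.1 (Finset.mem_coe.1 hy)
        have h2 := hg.1 x hx
        have h3 := hy.2
        simp only [rel] at h3
        simp only [Finset.coe_range, Set.mem_Iio]
        split_ifs <;> omega
      · intro y hy z hz hyz
        have hy := Finset.mem_filter.1 (Finset.mem_coe.1 hy)
        have hz := Finset.mem_filter.1 (Finset.mem_coe.1 hz)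
        apply hg.2 y hy.1 z hz.1
        have h2 := hg.1 x hx
        have h3 := hy.2
        have h4 := hz.2
        have h5 := hg.1 y hy.1
        have h6 := hg.1 z hz.1
        simp only [rel] at h3 h4
        simp only at hyz
        split_ifs at hyz <;> omega
    simpa using h1
  · intro x hx y hy hxy
    have h1 := hg.1 x hx
    have h2 := hg.1 y hy
    have h3 : g x ≠ g y := fun h => hxy (hg.2 x hx y hy h)
    by_cases hr : rel x y
    · exact Or.inl (Finset.mem_image_of_mem _ (Finset.mem_filter.2 ⟨hy, hr⟩))
    · right
      apply Finset.mem_image_of_mem _ (Finset.mem_filter.2 ⟨hx, ?_⟩)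
      simp only [rel] at hr ⊢
      omega

lemma avoid_one (S : Finset ℕ) (h : 2 ≤ S.card) (a : ℕ) : ∃ x ∈ S, x ≠ a := by
  obtain ⟨x, hx, hxa⟩ := Finset.exists_mem_ne (s := S) (by omega) a
  exact ⟨x, hx, hxa⟩

lemma avoid_two (S : Finset ℕ) (h : 3 ≤ S.card) (a b : ℕ) : ∃ x ∈ S, x ≠ a ∧ x ≠ b := by
  have h1 : ({a, b} : Finset ℕ).card < S.card := lt_of_le_of_lt Finset.card_le_two (by omega)
  obtain ⟨x, hx, hxa⟩ := Finset.exists_mem_notMem_of_card_lt_card h1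
  simp only [Finset.mem_insert, Finset.mem_singleton, not_or] at hxa
  exact ⟨x, hx, hxa⟩

lemma nx_mod (n : ℕ) (hn : 1 ≤ n) (j : ℕ) :
    (j + 1) % n = if j % n + 1 = n then 0 else j % n + 1 := by
  have h1 := Nat.mod_lt j (show n > 0 by omega)
  rw [← Nat.mod_add_mod]
  split_ifs with h
  · rw [h, Nat.mod_self]
  · rw [Nat.mod_eq_of_lt (by omega)]

/-- Colouring the cycle. -/
lemma cycle_color (n : ℕ) (hn : 7 ≤ n) (A : ℕ → Finset ℕ) (h2 : ∀ j, 2 ≤ (A j).card)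
    (h3 : ∀ j, j % 2 = 1 → j + 2 ≤ n → 3 ≤ (A j).card) (h30 : 3 ≤ (A 0).card)
    (h3n : 3 ≤ (A (n - 1)).card) :
    ∃ ec : ℕ → ℕ, (∀ j < n, ec j ∈ A j) ∧ (∀ j, ec (j % n) ≠ ec ((j + 1) % n)) ∧
      ∀ j, ¬ (ec (j % n) = ec ((j + 2) % n) ∧ ec ((j + 1) % n) = ec ((j + 3) % n)) := by
  -- reduction
  suffices h : ∃ (ec : ℕ → ℕ) (good : ℕ → Prop), (∀ j < n, ec j ∈ A j) ∧
      (∀ j < n, ec j ≠ ec (if j + 1 = n then 0 else j + 1)) ∧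
      (∀ j < n, good j → ec j ≠ ec (if j + 2 = n then 0 else if j + 1 = n then 1 else j + 2)) ∧
      (∀ j < n, good j ∨ good (if j + 1 = n then 0 else j + 1)) by
    obtain ⟨ec, good, e1, e2, e3, e4⟩ := h
    have m1 := nx_mod n (by omega)
    have m2 : ∀ j, (j + 2) % n =
        if j % n + 2 = n then 0 else if j % n + 1 = n then 1 else j % n + 2 := by
      intro j
      have := m1 (j + 1)
      rw [m1 j] at this
      rw [show j + 2 = j + 1 + 1 by ring, this]
      split_ifs <;> omega
    have hlt : ∀ j, j % n < n := fun j => Nat.mod_lt j (by omega)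
    refine ⟨ec, e1, ?_, ?_⟩
    · intro j
      have := e2 (j % n) (hlt j)
      rwa [← m1 j] at this
    · rintro j ⟨a, b⟩
      have h4 := e4 (j % n) (hlt j)
      rw [← m1 j] at h4
      rcases h4 with h | h
      · have := e3 (j % n) (hlt j) h
        rw [← m2 j] at this
        exact this a
      · have := e3 ((j + 1) % n) (hlt _) h
        rw [← m2 (j + 1)] at this
        exact this b
  obtain ⟨g, hg, hg'⟩ : ∃ g : ℕ → ℕ, (∀ i, g i ∈ A (2 * i)) ∧ ∀ i, g (i + 1) ≠ g i := by
    choose p hp using fun (i a : ℕ) => avoid_one (A (2 * (i + 1))) (h2 _) a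
    obtain ⟨a0, ha0⟩ : (A 0).Nonempty := Finset.card_pos.1 (by omega)
    let g : ℕ → ℕ := fun i => Nat.rec a0 (fun i a => p i a) i
    refine ⟨g, ?_, ?_⟩
    · intro i
      rcases i with _ | i
      · exact ha0
      · exact (hp i (g i)).1
    · intro i
      exact (hp i (g i)).2
  rcases Nat.even_or_odd' n with ⟨m, hm | hm⟩
  · -- even
    obtain ⟨a, haA, ha1, ha2⟩ := avoid_two (A 0) h30 (g 1) (g (m - 1))
    let ev : ℕ → ℕ := fun j => if j = 0 ∨ j = n then a else g (j / 2)
    have ho : ∀ j, ∃ x, j % 2 = 1 → j < n → x ∈ A j ∧ x ≠ ev (j - 1) ∧ x ≠ ev (j + 1) := by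
      intro j
      by_cases hj : j % 2 = 1 ∧ j < n
      · obtain ⟨x, hx, hx'⟩ := avoid_two (A j) (by
          by_cases hjn : j + 2 ≤ n
          · exact h3 j hj.1 hjn
          · have : j = n - 1 := by omega
            rw [this]; exact h3n) (ev (j - 1)) (ev (j + 1))
        exact ⟨x, fun _ _ => ⟨hx, hx'⟩⟩
      · exact ⟨0, fun h1 h2 => absurd ⟨h1, h2⟩ hj⟩
    choose o ho using ho
    have hev0 : ev 0 = a := if_pos (Or.inl rfl)
    have hevn : ev n = a := if_pos (Or.inr rfl)
    have hevi : ∀ j, 0 < j → j < n → ev j = g (j / 2) := fun j h1 h2 => if_neg (by omega)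
    refine ⟨fun j => if j % 2 = 1 then o j else ev j, fun j => j % 2 = 0, ?_, ?_, ?_, ?_⟩
    · intro j hj
      by_cases hp : j % 2 = 1
      · simp only [if_pos hp]
        exact (ho j hp hj).1
      · simp only [if_neg hp]
        by_cases hj0 : j = 0
        · rw [hj0, hev0]; exact haA
        · rw [hevi j (by omega) hj]
          have := hg (j / 2)
          rwa [show 2 * (j / 2) = j by omega] at this
    · intro j hj
      by_cases hp : j % 2 = 1
      · have := (ho j hp hj).2.2
        simp only [if_pos hp]
        by_cases hjn : j + 1 = n
        · rw [if_pos hjn, if_neg (by norm_num), hev0, ← hevn, ← hjn]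
          exact this
        · rw [if_neg hjn, if_neg (by omega)]
          exact this
      · have := (ho (j + 1) (by omega) (by omega)).2.1
        simp only [if_neg hp]
        rw [if_neg (show ¬ j + 1 = n by omega), if_pos (show (j + 1) % 2 = 1 by omega)]
        exact this.symm
    · intro j hj hgood
      simp only [if_neg (show ¬ j % 2 = 1 by omega)]
      by_cases hjn : j + 2 = n
      · rw [if_pos hjn, if_neg (by norm_num), hev0, hevi j (by omega) hj,
          show j / 2 = m - 1 by omega]
        exact ha2.symm
      · rw [if_neg hjn, if_neg (show ¬ j + 1 = n by omega),
          if_neg (show ¬ (j + 2) % 2 = 1 by omega), hevi (j + 2) (by omega) (by omega),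
          show (j + 2) / 2 = j / 2 + 1 by omega]
        by_cases hj0 : j = 0
        · rw [hj0, hev0]; exact ha1
        · rw [hevi j (by omega) hj]
          exact (hg' _).symm
    · intro j hj
      simp only
      split_ifs <;> omega
  · -- odd
    have ho : ∀ j, ∃ x, j % 2 = 1 → j + 2 ≤ n → x ∈ A j ∧ x ≠ g (j / 2) ∧ x ≠ g (j / 2 + 1) := by
      intro j
      by_cases hj : j % 2 = 1 ∧ j + 2 ≤ n
      · obtain ⟨x, hx, hx'⟩ := avoid_two (A j) (h3 j hj.1 hj.2) (g (j / 2)) (g (j / 2 + 1))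
        exact ⟨x, fun _ _ => ⟨hx, hx'⟩⟩
      · exact ⟨0, fun h1 h2 => absurd ⟨h1, h2⟩ hj⟩
    choose o ho using ho
    obtain ⟨z, hzA, hz1, hz2⟩ := avoid_two (A (2 * m - 1)) (h3 _ (by omega) (by omega))
      (g (m - 1)) (o (2 * m - 3))
    obtain ⟨a, haA, ha1, ha2⟩ := avoid_two (A 0) h30 (g 1) z
    obtain ⟨w, hwA, hw1, hw2⟩ := avoid_two (A (n - 1)) h3n a z
    obtain ⟨b, hbA, hb1, hb2⟩ := avoid_two (A 1) (h3 1 (by norm_num) (by omega)) a (g 1)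
    obtain ⟨ec, hec⟩ : ∃ ec : ℕ → ℕ, ec = fun j => if j = 0 then a else if j = 1 then b
      else if j = 2 * m then w else if j = 2 * m - 1 then z else if j % 2 = 0 then g (j / 2)
      else o j := ⟨_, rfl⟩
    have c0 : ec 0 = a := by rw [hec]; rfl
    have c1 : ec 1 = b := by rw [hec]; rfl
    have c2 : ec (2 * m) = w := by
      rw [hec]; simp only
      rw [if_neg (by omega), if_neg (by omega), if_pos trivial]
    have c3 : ec (2 * m - 1) = z := by
      rw [hec]; simp only
      rw [if_neg (by omega), if_neg (by omega), if_neg (by omega), if_pos trivial]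
    have c4 : ∀ i, 1 ≤ i → i ≤ m - 1 → ec (2 * i) = g i := by
      intro i h1 h2
      rw [hec]; simp only
      rw [if_neg (by omega), if_neg (by omega), if_neg (by omega), if_neg (by omega),
        if_pos (by omega), show 2 * i / 2 = i by omega]
    have c5 : ∀ i, 1 ≤ i → i ≤ m - 2 → ec (2 * i + 1) = o (2 * i + 1) := by
      intro i h1 h2
      rw [hec]; simp only
      rw [if_neg (by omega), if_neg (by omega), if_neg (by omega), if_neg (by omega),
        if_neg (by omega)]
    have ho' : ∀ i, i ≤ m - 2 → o (2 * i + 1) ∈ A (2 * i + 1) ∧ o (2 * i + 1) ≠ g i ∧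
        o (2 * i + 1) ≠ g (i + 1) := by
      intro i hi
      have := ho (2 * i + 1) (by omega) (by omega)
      rwa [show (2 * i + 1) / 2 = i by omega] at this
    have hcases : ∀ j < n, j = 0 ∨ j = 1 ∨ j = 2 * m ∨ j = 2 * m - 1 ∨
        (∃ i, 1 ≤ i ∧ i ≤ m - 1 ∧ j = 2 * i) ∨ (∃ i, 1 ≤ i ∧ i ≤ m - 2 ∧ j = 2 * i + 1) := by
      intro j hj
      rcases Nat.even_or_odd' j with ⟨i, hi | hi⟩
      · by_cases h0 : i = 0
        · left; omega
        · by_cases hm : i = m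
          · right; right; left; omega
          · right; right; right; right; left
            exact ⟨i, by omega, by omega, hi⟩
      · by_cases h0 : i = 0
        · right; left; omega
        · by_cases hm : i = m - 1
          · right; right; right; left; omega
          · right; right; right; right; right
            exact ⟨i, by omega, by omega, hi⟩
    refine ⟨ec, fun j => (j % 2 = 0 ∧ j + 4 ≤ 2 * m) ∨ j = 2 * m - 3 ∨ j = 2 * m - 1, ?_, ?_, ?_, ?_⟩
    · intro j hj
      rcases hcases j hj with rfl | rfl | rfl | rfl | ⟨i, h1, h2, rfl⟩ | ⟨i, h1, h2, rfl⟩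
      · rw [c0]; exact haA
      · rw [c1]; exact hbA
      · rw [c2, show 2 * m = n - 1 by omega]; exact hwA
      · rw [c3]; exact hzA
      · rw [c4 i h1 h2]; exact hg i
      · rw [c5 i h1 h2]; exact (ho' i h2).1
    · intro j hj
      rcases hcases j hj with rfl | rfl | rfl | rfl | ⟨i, h1, h2, rfl⟩ | ⟨i, h1, h2, rfl⟩
      · rw [if_neg (by omega), c0, c1]; exact hb1.symm
      · rw [if_neg (by omega), c1]
        have := c4 1 (by omega) (by omega)
        rw [show 1 + 1 = 2 * 1 by ring, this]
        exact hb2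
      · rw [if_pos (by omega), c2, c0]; exact hw1
      · rw [if_neg (by omega), show 2 * m - 1 + 1 = 2 * m by omega, c3, c2]
        exact hw2.symm
      · rw [if_neg (by omega), c4 i h1 h2]
        by_cases hi : i = m - 1
        · rw [show 2 * i + 1 = 2 * m - 1 by omega, c3, hi]
          exact hz1.symm
        · rw [c5 i h1 (by omega)]
          exact (ho' i (by omega)).2.1.symm
      · rw [if_neg (by omega), c5 i h1 h2, show 2 * i + 1 + 1 = 2 * (i + 1) by ring,
          c4 (i + 1) (by omega) (by omega)]
        exact (ho' i h2).2.2
    · intro j hj hgood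
      rcases hgood with ⟨hp, h4⟩ | rfl | rfl
      · rw [if_neg (by omega), if_neg (by omega)]
        obtain ⟨i, rfl⟩ : ∃ i, j = 2 * i := ⟨j / 2, by omega⟩
        rw [show 2 * i + 2 = 2 * (i + 1) by ring, c4 (i + 1) (by omega) (by omega)]
        by_cases hi : i = 0
        · subst hi
          rw [Nat.mul_zero, c0]
          exact ha1
        · rw [c4 i (by omega) (by omega)]
          exact (hg' i).symm
      · rw [if_neg (by omega), if_neg (by omega), show 2 * m - 3 + 2 = 2 * m - 1 by omega, c3]
        have := c5 (m - 2) (by omega) (by omega)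
        rw [show 2 * (m - 2) + 1 = 2 * m - 3 by omega] at this
        rw [this]
        exact hz2.symm
      · rw [if_pos (by omega), c3, c0]
        exact ha2.symm
    · intro j hj
      simp only
      split_ifs <;> omega

lemma pad_set (h : ℕ) (S F1 : Finset ℕ) (hS : S.card ≤ 2 * h + 1) (hF : F1.card ≤ h + 1) :
    ∃ F : Finset ℕ, F1 ∩ S ⊆ F ∧ F.card ≤ h + 1 ∧ (S \ F).card ≤ h := by
  have h1 : (F1 ∩ S).card ≤ h + 1 := (Finset.card_le_card Finset.inter_subset_left).trans hF
  have h2 : (F1 ∩ S).card ≤ S.card := Finset.card_le_card Finset.inter_subset_right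
  obtain ⟨F, hF1, hFS, hFc⟩ := Finset.exists_subsuperset_card_eq (s := F1 ∩ S) (t := S)
    (n := min (h + 1) S.card) Finset.inter_subset_right (by omega) (by omega)
  refine ⟨F, hF1, by omega, ?_⟩
  have := Finset.card_sdiff_add_card_eq_card hFS
  omega

/-- One step of Stage 1 at a non-root vertex. -/
lemma step_nonroot {V : Type*} (h k Δ : ℕ) (hh : 5 ≤ h) (hk : k = Δ + h) (hk6 : 2 * h + 6 ≤ k)
    (hΔ : Δ ≤ 2 * h + 1)
    (s : Finset V) (u : V) (hu : u ∉ s) (hs : s.card + 1 ≤ Δ) (L : V → Finset ℕ)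
    (hL : ∀ v ∈ s, k ≤ (L v).card) (Φu Sp : Finset ℕ) (pc : ℕ) (hpc : pc ∈ Φu)
    (hΦ : Φu.card ≤ h + 1) (hSp : (Sp \ Φu).card ≤ h) :
    ∃ (c : V → ℕ) (F : V → Finset ℕ), ∀ v ∈ s, c v ∈ L v ∧ c v ∉ Φu ∧ c v ∈ F v ∧
      (F v).card ≤ h + 1 ∧ (∀ w ∈ s, w ≠ v → c w ≠ c v ∧ (c w ∈ F v ∨ c v ∈ F w)) ∧
      (c v ∈ Sp → pc ∈ F v) ∧ ((insert pc (s.image c)) \ F v).card ≤ h := by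
  obtain ⟨c, hc1, hc2⟩ := sdr_exists s (fun v => L v \ Φu) (by
    intro v hv
    have h1 := hL v hv
    have h2 := Finset.le_card_sdiff Φu (L v)
    omega)
  simp only [Finset.mem_sdiff] at hc1
  have hinj : ∀ x ∈ s, ∀ y ∈ s, c x = c y → x = y := by
    intro x hx y hy hxy
    by_contra hne
    exact hc2 x hx y hy hne hxy
  have hB : (s.filter (fun v => c v ∈ Sp)).card ≤ h := by
    refine le_trans (Finset.card_le_card_of_injOn c ?_ ?_) hSp
    · intro v hv
      have hv := Finset.mem_filter.1 (Finset.mem_coe.1 hv)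
      exact Finset.mem_coe.2 (Finset.mem_sdiff.2 ⟨hv.2, (hc1 v hv.1).2⟩)
    · intro v hv w hw hvw
      have hv := Finset.mem_filter.1 (Finset.mem_coe.1 hv)
      have hw := Finset.mem_filter.1 (Finset.mem_coe.1 hw)
      exact hinj v hv.1 w hw.1 hvw
  obtain ⟨F0, hF0c, hF0t, hF0B, _, _⟩ := star_lemma h k hh hk6 s c hinj (by omega) pc
    (by
      intro x hx hxp
      exact (hc1 x hx).2 (hxp ▸ hpc)) (s.filter (fun v => c v ∈ Sp)) (Finset.filter_subset _ _)
    u hB (fun h => absurd h hu) (fun _ => ∅) (fun _ => ∅) ∅ ∅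
  have hSc : (insert pc (s.image c)).card ≤ 2 * h + 1 := by
    have h1 := Finset.card_insert_le pc (s.image c)
    have h2 := Finset.card_image_le (s := s) (f := c)
    omega
  have hF : ∀ v, ∃ F : Finset ℕ, v ∈ s → (insert (c v) (F0 v)) ∩ insert pc (s.image c) ⊆ F ∧
      F.card ≤ h + 1 ∧ (insert pc (s.image c) \ F).card ≤ h := by
    intro v
    by_cases hv : v ∈ s
    · obtain ⟨F, hF⟩ := pad_set h (insert pc (s.image c)) (insert (c v) (F0 v)) hSc
        ((Finset.card_insert_le _ _).trans (Nat.succ_le_succ (hF0c v hv)))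
      exact ⟨F, fun _ => hF⟩
    · exact ⟨∅, fun h => absurd h hv⟩
  choose F hF using hF
  have hcS : ∀ v ∈ s, c v ∈ insert pc (s.image c) := fun v hv =>
    Finset.mem_insert_of_mem (Finset.mem_image_of_mem _ hv)
  refine ⟨c, F, ?_⟩
  intro v hv
  refine ⟨(hc1 v hv).1, (hc1 v hv).2, ?_, (hF v hv).2.1, ?_, ?_, (hF v hv).2.2⟩
  · exact (hF v hv).1 (Finset.mem_inter.2 ⟨Finset.mem_insert_self _ _, hcS v hv⟩)
  · intro w hw hwv
    refine ⟨hc2 w hw v hv hwv, ?_⟩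
    rcases hF0t v hv w hw hwv.symm with h | h
    · exact Or.inl ((hF v hv).1 (Finset.mem_inter.2 ⟨Finset.mem_insert_of_mem h, hcS w hw⟩))
    · exact Or.inr ((hF w hw).1 (Finset.mem_inter.2 ⟨Finset.mem_insert_of_mem h, hcS v hv⟩))
  · intro hvS
    have := hF0B v (Finset.mem_filter.2 ⟨hv, hvS⟩)
    exact (hF v hv).1 (Finset.mem_inter.2 ⟨Finset.mem_insert_of_mem this, Finset.mem_insert_self _ _⟩)

/-- One step of Stage 1 at the root. -/
lemma step_root {V : Type*} (h k Δ : ℕ) (hk : k = Δ + h)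
    (hΔ : Δ ≤ 2 * h + 1) (s : Finset V) (hs : s.card ≤ Δ) (L : V → Finset ℕ)
    (hL : ∀ v ∈ s, k ≤ (L v).card) :
    ∃ (c : V → ℕ) (F : V → Finset ℕ), ∀ v ∈ s, c v ∈ L v ∧ c v ∈ F v ∧
      (F v).card ≤ h + 1 ∧ (∀ w ∈ s, w ≠ v → c w ≠ c v ∧ (c w ∈ F v ∨ c v ∈ F w)) ∧
      ((s.image c) \ F v).card ≤ h := by
  obtain ⟨c, hc1, hc2⟩ := sdr_exists s L (by
    intro v hv
    have h1 := hL v hv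
    omega)
  obtain ⟨F0, hF0c, hF0t⟩ := circ_lemma h s (by omega) c
  have hSc : (s.image c).card ≤ 2 * h + 1 := by
    have h2 := Finset.card_image_le (s := s) (f := c)
    omega
  have hF : ∀ v, ∃ F : Finset ℕ, v ∈ s → (insert (c v) (F0 v)) ∩ s.image c ⊆ F ∧
      F.card ≤ h + 1 ∧ (s.image c \ F).card ≤ h := by
    intro v
    by_cases hv : v ∈ s
    · obtain ⟨F, hF⟩ := pad_set h (s.image c) (insert (c v) (F0 v)) hSc
        ((Finset.card_insert_le _ _).trans (Nat.succ_le_succ (hF0c v hv)))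
      exact ⟨F, fun _ => hF⟩
    · exact ⟨∅, fun h => absurd h hv⟩
  choose F hF using hF
  have hcS : ∀ v ∈ s, c v ∈ s.image c := fun v hv => Finset.mem_image_of_mem _ hv
  refine ⟨c, F, ?_⟩
  intro v hv
  refine ⟨hc1 v hv, ?_, (hF v hv).2.1, ?_, (hF v hv).2.2⟩
  · exact (hF v hv).1 (Finset.mem_inter.2 ⟨Finset.mem_insert_self _ _, hcS v hv⟩)
  · intro w hw hwv
    refine ⟨hc2 w hw v hv hwv, ?_⟩
    rcases hF0t v hv w hw hwv.symm with h | h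
    · exact Or.inl ((hF v hv).1 (Finset.mem_inter.2 ⟨Finset.mem_insert_of_mem h, hcS w hw⟩))
    · exact Or.inr ((hF w hw).1 (Finset.mem_inter.2 ⟨Finset.mem_insert_of_mem h, hcS v hv⟩))

/-- Children. -/
noncomputable def chs {V : Type*} [Fintype V] (r : V) (par : V → V) (u : V) : Finset V :=
  Finset.univ.filter (fun v => v ≠ r ∧ par v = u)

/-- Colours of the tree edges at a vertex. -/
noncomputable def Sset {V : Type*} [Fintype V] (r : V) (par : V → V) (c : V → ℕ) (u : V) :
    Finset ℕ :=
  (if u = r then ∅ else {c u}) ∪ (chs r par u).image c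

lemma mem_chs {V : Type*} [Fintype V] {r : V} {par : V → V} {u v : V} :
    v ∈ chs r par u ↔ v ≠ r ∧ par v = u := by
  simp [chs]

lemma mem_Sset {V : Type*} [Fintype V] {r : V} {par : V → V} {c : V → ℕ} {u : V} {a : ℕ} :
    a ∈ Sset r par c u ↔ (u ≠ r ∧ a = c u) ∨ ∃ v, v ≠ r ∧ par v = u ∧ c v = a := by
  by_cases h : u = r <;> simp [Sset, chs, h, and_assoc]

/-- The invariant of Stage 1. -/
def StageInv {V : Type*} [Fintype V] (r : V) (par : V → V) (dep : V → ℕ) (h : ℕ)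
    (L : V → Finset ℕ) (d : ℕ) (c : V → ℕ) (Φ : V → Finset ℕ) : Prop :=
  Φ r = ∅ ∧ ∀ v, v ≠ r → dep v ≤ d →
    c v ∈ L v ∧ c v ∈ Φ v ∧ (Φ v).card ≤ h + 1 ∧ c v ∉ Φ (par v) ∧
    (∀ w, w ≠ r → par w = par v → w ≠ v → c w ≠ c v ∧ (c w ∈ Φ v ∨ c v ∈ Φ w)) ∧
    (par v ≠ r → c v ∈ Sset r par c (par (par v)) → c (par v) ∈ Φ v) ∧
    (Sset r par c (par v) \ Φ v).card ≤ h

lemma stage_one {V : Type*} [Fintype V] (r : V) (par : V → V) (dep : V → ℕ)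
    (hdr : dep r = 0) (hdep : ∀ v, v ≠ r → dep v = dep (par v) + 1)
    (h k Δ : ℕ) (hh : 5 ≤ h) (hk : k = Δ + h) (hk6 : 2 * h + 6 ≤ k) (hΔ : Δ ≤ 2 * h + 1)
    (hchr : (chs r par r).card ≤ Δ) (hchu : ∀ u, u ≠ r → (chs r par u).card + 1 ≤ Δ)
    (L : V → Finset ℕ) (hL : ∀ v, v ≠ r → k ≤ (L v).card) (d : ℕ) :
    ∃ (c : V → ℕ) (Φ : V → Finset ℕ), StageInv r par dep h L d c Φ := by
  induction d with
  | zero =>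
    refine ⟨fun _ => 0, fun _ => ∅, rfl, ?_⟩
    intro v hv hd
    have := hdep v hv
    omega
  | succ d ih =>
    obtain ⟨c, Φ, hΦr, hI⟩ := ih
    -- one star at a time
    have hstep : ∀ u, ∃ (cu : V → ℕ) (F : V → Finset ℕ), dep u = d → ∀ v ∈ chs r par u,
        cu v ∈ L v ∧ cu v ∉ Φ u ∧ cu v ∈ F v ∧
        (F v).card ≤ h + 1 ∧
        (∀ w ∈ chs r par u, w ≠ v → cu w ≠ cu v ∧ (cu w ∈ F v ∨ cu v ∈ F w)) ∧
        (u ≠ r → cu v ∈ Sset r par c (par u) → c u ∈ F v) ∧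
        (((if u = r then ∅ else {c u}) ∪ (chs r par u).image cu) \ F v).card ≤ h := by
      intro u
      by_cases hu : dep u = d
      · by_cases hur : u = r
        · subst hur
          obtain ⟨cu, F, hF⟩ := step_root h k Δ hk hΔ (chs u par u) hchr L
            (fun v hv => hL v (mem_chs.1 hv).1)
          refine ⟨cu, F, fun _ v hv => ?_⟩
          obtain ⟨f1, f2, f3, f4, f5⟩ := hF v hv
          refine ⟨f1, by simp [hΦr], f2, f3, f4, fun h => absurd rfl h, ?_⟩
          simpa using f5
        · obtain ⟨g1, g2, g3, g4, g5, g6, g7⟩ := hI u hur (by omega)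
          obtain ⟨cu, F, hF⟩ := step_nonroot h k Δ hh hk hk6 hΔ (chs r par u) u
            (by
              intro hc
              have h1 := mem_chs.1 hc
              have h2 := hdep u hur
              rw [h1.2] at h2
              omega) (hchu u hur) L
            (fun v hv => hL v (mem_chs.1 hv).1) (Φ u) (Sset r par c (par u)) (c u) g2 g3 g7
          refine ⟨cu, F, fun _ v hv => ?_⟩
          obtain ⟨f1, f2, f3, f4, f5, f6, f7⟩ := hF v hv
          refine ⟨f1, f2, f3, f4, f5, fun _ => f6, ?_⟩
          rw [if_neg hur]
          exact f7
      · exact ⟨fun _ => 0, fun _ => ∅, fun h => absurd h hu⟩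
    choose cu F hF using hstep
    obtain ⟨c', hc'⟩ : ∃ c' : V → ℕ, c' = fun v => if dep v = d + 1 then cu (par v) v else c v :=
      ⟨_, rfl⟩
    obtain ⟨Φ', hΦ'⟩ : ∃ Φ' : V → Finset ℕ,
      Φ' = fun v => if dep v = d + 1 then F (par v) v else Φ v := ⟨_, rfl⟩
    have c1 : ∀ v, dep v = d + 1 → c' v = cu (par v) v := by
      intro v hv; rw [hc']; exact if_pos hv
    have c2 : ∀ v, dep v ≤ d → c' v = c v := by
      intro v hv; rw [hc']; exact if_neg (by omega)
    have p1 : ∀ v, dep v = d + 1 → Φ' v = F (par v) v := by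
      intro v hv; rw [hΦ']; exact if_pos hv
    have p2 : ∀ v, dep v ≤ d → Φ' v = Φ v := by
      intro v hv; rw [hΦ']; exact if_neg (by omega)
    have s2 : ∀ u, dep u + 1 ≤ d → Sset r par c' u = Sset r par c u := by
      intro u hu
      ext a
      rw [mem_Sset, mem_Sset, c2 u (by omega)]
      constructor
      · rintro (h | ⟨v, h1, h2, h3⟩)
        · exact Or.inl h
        · refine Or.inr ⟨v, h1, h2, ?_⟩
          rw [← c2 v (by have := hdep v h1; rw [h2] at this; omega)]
          exact h3
      · rintro (h | ⟨v, h1, h2, h3⟩)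
        · exact Or.inl h
        · refine Or.inr ⟨v, h1, h2, ?_⟩
          rw [c2 v (by have := hdep v h1; rw [h2] at this; omega)]
          exact h3
    refine ⟨c', Φ', ?_, ?_⟩
    · rw [p2 r (by omega)]; exact hΦr
    intro v hvr hvd
    have hdv := hdep v hvr
    by_cases hv : dep v ≤ d
    · obtain ⟨g1, g2, g3, g4, g5, g6, g7⟩ := hI v hvr hv
      rw [c2 v hv, p2 v hv, p2 (par v) (by omega), s2 (par v) (by omega), c2 (par v) (by omega)]
      refine ⟨g1, g2, g3, g4, ?_, ?_, g7⟩
      · intro w hw hwv hne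
        have hw' := hdep w hw
        rw [hwv] at hw'
        rw [c2 w (by omega), p2 w (by omega)]
        exact g5 w hw hwv hne
      · intro hpr
        have := hdep _ hpr
        rw [s2 _ (by omega)]
        exact g6 hpr
    · have hv1 : dep v = d + 1 := by omega
      obtain ⟨g1, g2, g3, g4, g5, g6, g7⟩ := hF (par v) (by omega) v (mem_chs.2 ⟨hvr, rfl⟩)
      rw [c1 v hv1, p1 v hv1, p2 (par v) (by omega), c2 (par v) (by omega)]
      refine ⟨g1, g3, g4, g2, ?_, ?_, ?_⟩
      · intro w hw hwv hne
        have hw' := hdep w hw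
        rw [hwv] at hw'
        rw [c1 w (by omega), p1 w (by omega), hwv]
        exact g5 w (mem_chs.2 ⟨hw, hwv⟩) hne
      · intro hpr
        have := hdep _ hpr
        rw [s2 _ (by omega)]
        exact g6 hpr
      · refine le_trans (Finset.card_le_card ?_) g7
        intro a ha
        rw [Finset.mem_sdiff, mem_Sset, c2 (par v) (by omega)] at ha
        rw [Finset.mem_sdiff, Finset.mem_union, Finset.mem_image]
        refine ⟨?_, ha.2⟩
        rcases ha.1 with ⟨h1, h2⟩ | ⟨w, h1, h2, h3⟩
        · left
          rw [if_neg h1, h2]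
          simp
        · right
          refine ⟨w, mem_chs.2 ⟨h1, h2⟩, ?_⟩
          have hw' := hdep w h1
          rw [h2] at hw'
          rw [c1 w (by omega), h2] at h3
          exact h3

lemma internal_good (h k : ℕ) (hk : 2 * h + 6 ≤ k) (L F F' Q : Finset ℕ) (hL : k ≤ L.card)
    (hF : F.card ≤ h) (hF' : F'.card ≤ h) (hQ : Q.card ≤ 4) (z : ℕ) (hz : z ∈ Q)
    (hzF : z ∈ F ∨ z ∈ F') : 3 ≤ (L \ (F ∪ F' ∪ Q)).card := by
  have h1 := Finset.le_card_sdiff (F ∪ F' ∪ Q) L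
  have h2 : F ∪ F' ∪ Q ⊆ (F ∪ F') ∪ Q.erase z := by
    intro w hw
    simp only [Finset.mem_union, Finset.mem_erase] at *
    by_cases hwz : w = z
    · subst hwz; tauto
    · tauto
  have h3 := Finset.card_le_card h2
  have h4 := Finset.card_union_le (F ∪ F') (Q.erase z)
  have h5 := Finset.card_union_le F F'
  have h6 := Finset.card_erase_add_one hz
  omega

lemma union_perm1 (A B Q : Finset ℕ) : (B ∪ Q) ∪ A = A ∪ B ∪ Q := by
  rw [Finset.union_comm, Finset.union_assoc]

lemma union_perm2 (A B Q : Finset ℕ) : (A ∪ Q) ∪ B = A ∪ B ∪ Q := by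
  rw [Finset.union_right_comm]

set_option maxHeartbeats 1000000 in
/-- Stage 3: choosing the forbidden sets of the leaves. -/
lemma stage_three {V : Type*} (h k : ℕ) (hh : 5 ≤ h) (hk : 2 * h + 6 ≤ k)
    (n : ℕ) (hn : 3 ≤ n) (x : ℕ → V) (hxn : ∀ j, x (j + n) = x j)
    (hinj : ∀ i < n, ∀ j < n, x i = x j → i = j) (par : V → V) (c : V → ℕ)
    (st : V → Finset V) (hst : ∀ u v, v ∈ st u ↔ (∃ j < n, x j = v) ∧ par v = u)
    (hc : ∀ i j, x i ≠ x j → par (x i) = par (x j) → c (x i) ≠ c (x j))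
    (hcard : ∀ u, (st u).card ≤ 2 * h) (hpc : ∀ j, c (x j) ≠ c (par (x j)))
    (Bad : V → Prop) (hB : ∀ u, ((st u).filter Bad).card ≤ h)
    (hx0 : Bad (x 0) ∨ ∀ j, ¬ Bad (x j))
    (LE Q : ℕ → Finset ℕ) (hLE : ∀ j, k ≤ (LE j).card) (hQc : ∀ j, (Q j).card ≤ 4)
    (hQ : ∀ j, c (x j) ∈ Q j ∧ c (x (j + 1)) ∈ Q j) :
    ∃ F : V → Finset ℕ, (∀ v, (F v).card ≤ h) ∧
      (∀ i j, x i ≠ x j → par (x i) = par (x j) → c (x j) ∈ F (x i) ∨ c (x i) ∈ F (x j)) ∧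
      (∀ j, Bad (x j) → c (par (x j)) ∈ F (x j)) ∧
      (∀ j, j % 2 = 1 → j + 2 ≤ n → 3 ≤ (LE j \ (F (x j) ∪ F (x (j + 1)) ∪ Q j)).card) ∧
      3 ≤ (LE 0 \ (F (x 0) ∪ F (x 1) ∪ Q 0)).card ∧
      3 ≤ (LE (n - 1) \ (F (x (n - 1)) ∪ F (x n) ∪ Q (n - 1))).card := by
  have hmod : ∀ j, x (j % n) = x j := by
    intro j
    have : ∀ q a, x (a + n * q) = x a := by
      intro q
      induction q with
      | zero => intro a; rfl
      | succ q ih => intro a; rw [Nat.mul_succ, ← Nat.add_assoc, hxn, ih]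
    conv_rhs => rw [← Nat.mod_add_div j n]
    rw [this]
  have hstx : ∀ j, x j ∈ st (par (x j)) := fun j =>
    (hst _ _).2 ⟨⟨j % n, Nat.mod_lt _ (by omega), hmod j⟩, rfl⟩
  have hidx : ∃ idx : V → ℕ, ∀ j < n, idx (x j) = j := by
    refine ⟨fun v => if hv : ∃ j < n, x j = v then hv.choose else 0, ?_⟩
    intro j hj
    have hv : ∃ i < n, x i = x j := ⟨j, hj, rfl⟩
    simp only [dif_pos hv]
    exact hinj _ hv.choose_spec.1 j hj hv.choose_spec.2
  obtain ⟨idx, hidx⟩ := hidx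
  let req : V → ℕ := fun v => if idx v % 2 = 1 then idx v else if idx v = 0 then n - 1 else idx v - 1
  let oth : V → V := fun v => if idx v % 2 = 1 then x (idx v + 1) else
    if idx v = 0 then x (n - 1) else x (idx v - 1)
  -- one star
  have hstep : ∀ (F : V → Finset ℕ) (u : V), (∀ v, (F v).card ≤ h) → ∃ F' : V → Finset ℕ,
      (∀ v, v ∉ st u → F' v = F v) ∧ (∀ v, (F' v).card ≤ h) ∧
      (∀ v ∈ st u, ∀ w ∈ st u, v ≠ w → c w ∈ F' v ∨ c v ∈ F' w) ∧
      (∀ v ∈ st u, Bad v → c u ∈ F' v) ∧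
      (∀ v ∈ st u, 3 ≤ (LE (req v) \ ((F (oth v) ∪ Q (req v)) ∪ F' v)).card) ∧
      (x 0 ∈ st u → 3 ≤ (LE 0 \ ((F (x 1) ∪ Q 0) ∪ F' (x 0))).card) := by
    intro F u hF
    obtain ⟨F', f1, f2, f3, f4, f5⟩ := star_lemma h k hh hk (st u) c (by
        intro v hv w hw hvw
        obtain ⟨⟨i, _, rfl⟩, hi⟩ := (hst _ _).1 hv
        obtain ⟨⟨j, _, rfl⟩, hj⟩ := (hst _ _).1 hw
        by_contra hne
        exact hc i j hne (hi.trans hj.symm) hvw) (hcard u) (c u) (by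
        intro v hv
        obtain ⟨⟨i, _, rfl⟩, hi⟩ := (hst _ _).1 hv
        rw [← hi]
        exact hpc i) ((st u).filter Bad) (Finset.filter_subset _ _) (x 0) (hB u) (by
        intro h0
        rcases hx0 with hb | hb
        · rw [Finset.insert_eq_of_mem (Finset.mem_filter.2 ⟨h0, hb⟩)]
          exact hB u
        · have : (st u).filter Bad = ∅ := by
            apply Finset.filter_eq_empty_iff.2
            intro v hv
            obtain ⟨⟨i, _, rfl⟩, hi⟩ := (hst _ _).1 hv
            exact hb i
          rw [this]
          simp only [insert_empty_eq, Finset.card_singleton]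
          omega)
      (fun v => LE (req v)) (fun v => F (oth v) ∪ Q (req v)) (LE 0) (F (x 1) ∪ Q 0)
    have hG : ∀ v j, (F v ∪ Q j).card ≤ h + 4 := by
      intro v j
      exact (Finset.card_union_le _ _).trans (Nat.add_le_add (hF v) (hQc j))
    have e1 : ∀ v, v ∈ st u → (if v ∈ st u then F' v else F v) = F' v := fun v hv => if_pos hv
    refine ⟨fun v => if v ∈ st u then F' v else F v, ?_, ?_, ?_, ?_, ?_, ?_⟩
    · intro v hv
      exact if_neg hv
    · intro v
      by_cases hv : v ∈ st u
      · simp only [if_pos hv]; exact f1 v hv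
      · simp only [if_neg hv]; exact hF v
    · intro v hv w hw hvw
      simp only [e1 v hv, e1 w hw]
      exact f2 v hv w hw hvw
    · intro v hv hb
      simp only [e1 v hv]
      exact f3 v (Finset.mem_filter.2 ⟨hv, hb⟩)
    · intro v hv
      simp only [e1 v hv]
      exact f4 v hv (hLE _) (hG _ _)
    · intro hv
      simp only [e1 _ hv]
      exact f5 hv (hLE _) (hG _ _)
  have hreq1 : ∀ j, j % 2 = 1 → j + 2 ≤ n → req (x j) = j ∧ oth (x j) = x (j + 1) ∧
      req (x (j + 1)) = j ∧ oth (x (j + 1)) = x j := by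
    intro j hj hjn
    simp only [req, oth, hidx j (by omega), hidx (j + 1) (by omega), if_pos hj,
      if_neg (show ¬ (j + 1) % 2 = 1 by omega), if_neg (show ¬ j + 1 = 0 by omega)]
    simp
  have hmem : ∀ u j, par (x j) = u → x j ∈ st u := fun u j hj => hj ▸ hstx j
  have hmem' : ∀ u j, x j ∈ st u → par (x j) = u := fun u j hj => ((hst _ _).1 hj).2
  have hsucc : ∀ j, x j ≠ x (j + 1) := by
    intro j hj
    rw [← hmod j, ← hmod (j + 1)] at hj
    have := hinj _ (Nat.mod_lt _ (by omega)) _ (Nat.mod_lt _ (by omega)) hj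
    rw [nx_mod n (by omega)] at this
    split_ifs at this <;> omega
  -- goodness after one more star
  have hgood : ∀ (F F' : V → Finset ℕ) (u : V), (∀ v, (F' v).card ≤ h) →
      (∀ v, v ∉ st u → F' v = F v) →
      (∀ v ∈ st u, ∀ w ∈ st u, v ≠ w → c w ∈ F' v ∨ c v ∈ F' w) →
      ∀ j, (x j ∈ st u → x (j + 1) ∉ st u → 3 ≤ (LE j \ ((F (x (j + 1)) ∪ Q j) ∪ F' (x j))).card) →
        (x (j + 1) ∈ st u → x j ∉ st u → 3 ≤ (LE j \ ((F (x j) ∪ Q j) ∪ F' (x (j + 1)))).card) →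
        (x j ∉ st u → x (j + 1) ∉ st u → 3 ≤ (LE j \ (F (x j) ∪ F (x (j + 1)) ∪ Q j)).card) →
        3 ≤ (LE j \ (F' (x j) ∪ F' (x (j + 1)) ∪ Q j)).card := by
    intro F F' u hF' hoff htot j g1 g2 g3
    by_cases ha : x j ∈ st u <;> by_cases hb : x (j + 1) ∈ st u
    · rcases htot _ ha _ hb (hsucc j) with h' | h'
      · exact internal_good h k hk _ _ _ _ (hLE j) (hF' _) (hF' _) (hQc j) _ (hQ j).2 (Or.inl h')
      · exact internal_good h k hk _ _ _ _ (hLE j) (hF' _) (hF' _) (hQc j) _ (hQ j).1 (Or.inr h')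
    · have := g1 ha hb
      rw [← hoff _ hb, union_perm1] at this
      exact this
    · have := g2 hb ha
      rw [← hoff _ ha, union_perm2] at this
      exact this
    · have := g3 ha hb
      rw [← hoff _ ha, ← hoff _ hb] at this
      exact this
  have hsd : ∀ u u' v, v ∈ st u → v ∈ st u' → u = u' := by
    intro u u' v h1 h2
    exact ((hst _ _).1 h1).2.symm.trans ((hst _ _).1 h2).2
  -- induction over stars other than that of `x 0`
  have hind : ∀ U : Finset V, ∃ F : V → Finset ℕ, (∀ v, (F v).card ≤ h) ∧
      (∀ u ∈ U, ∀ v ∈ st u, (∀ w ∈ st u, v ≠ w → c w ∈ F v ∨ c v ∈ F w) ∧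
        (Bad v → c u ∈ F v)) ∧
      (∀ j, j % 2 = 1 → j + 2 ≤ n → par (x j) ∈ U → par (x (j + 1)) ∈ U →
        3 ≤ (LE j \ (F (x j) ∪ F (x (j + 1)) ∪ Q j)).card) := by
    intro U
    induction U using Finset.induction_on with
    | empty => exact ⟨fun _ => ∅, by simp, by simp, by simp⟩
    | insert u U huU ih =>
      obtain ⟨F, i1, i2, i3⟩ := ih
      obtain ⟨F', f1, f2, f3, f4, f5, _⟩ := hstep F u i1
      refine ⟨F', f2, ?_, ?_⟩
      · intro u' hu' v hv
        rcases Finset.mem_insert.1 hu' with rfl | hu'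
        · exact ⟨fun w hw hne => f3 v hv w hw hne, f4 v hv⟩
        · have hne : ∀ v ∈ st u', v ∉ st u := by
            intro v hv hv'
            exact huU (hsd _ _ _ hv' hv ▸ hu')
          refine ⟨?_, ?_⟩
          · intro w hw hvw
            rw [f1 v (hne v hv), f1 w (hne w hw)]
            exact (i2 u' hu' v hv).1 w hw hvw
          · rw [f1 v (hne v hv)]
            exact (i2 u' hu' v hv).2
      · intro j hj hjn hja hjb
        obtain ⟨r1, r2, r3, r4⟩ := hreq1 j hj hjn
        apply hgood F F' u f2 f1 f3 j
        · intro ha _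
          have := f5 _ ha
          rwa [r1, r2] at this
        · intro ha _
          have := f5 _ ha
          rwa [r3, r4] at this
        · intro ha hb
          apply i3 j hj hjn
          · exact (Finset.mem_insert.1 hja).resolve_left (fun h => ha (hmem _ _ h))
          · exact (Finset.mem_insert.1 hjb).resolve_left (fun h => hb (hmem _ _ h))
  obtain ⟨F, i1, i2, i3⟩ := hind (((Finset.range n).image (fun j => par (x j))).erase (par (x 0)))
  have hU : ∀ j, par (x j) ≠ par (x 0) →
      par (x j) ∈ ((Finset.range n).image (fun j => par (x j))).erase (par (x 0)) := by
    intro j hj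
    refine Finset.mem_erase.2 ⟨hj, Finset.mem_image.2 ⟨j % n, ?_, ?_⟩⟩
    · exact Finset.mem_range.2 (Nat.mod_lt _ (by omega))
    · simp only [hmod]
  obtain ⟨F', f1, f2, f3, f4, f5, f6⟩ := hstep F (par (x 0)) i1
  have hnot : ∀ j, x j ∉ st (par (x 0)) → par (x j) ≠ par (x 0) := by
    intro j hj he
    exact hj (hmem _ _ he)
  have hnot' : ∀ j, par (x j) ≠ par (x 0) → x j ∉ st (par (x 0)) := by
    intro j hj he
    exact hj (hmem' _ _ he)
  have h0 : x 0 ∈ st (par (x 0)) := hstx 0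
  have hxn0 : x n = x 0 := by have := hxn 0; rwa [Nat.zero_add] at this
  refine ⟨F', f2, ?_, ?_, ?_, ?_, ?_⟩
  · intro i j hij hp
    by_cases hi : par (x i) = par (x 0)
    · exact f3 _ (hmem _ _ hi) _ (hmem _ _ (hp.symm.trans hi)) hij
    · rw [f1 _ (hnot' i hi), f1 _ (hnot' j (hp ▸ hi))]
      exact (i2 _ (hU i hi) _ (hstx i)).1 _ (hmem _ _ hp.symm) hij
  · intro j hb
    by_cases hj : par (x j) = par (x 0)
    · rw [hj]
      exact f4 _ (hmem _ _ hj) hb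
    · rw [f1 _ (hnot' j hj)]
      exact (i2 _ (hU j hj) _ (hstx j)).2 hb
  · intro j hj hjn
    obtain ⟨r1, r2, r3, r4⟩ := hreq1 j hj hjn
    apply hgood F F' _ f2 f1 f3 j
    · intro ha _
      have := f5 _ ha
      rwa [r1, r2] at this
    · intro ha _
      have := f5 _ ha
      rwa [r3, r4] at this
    · intro ha hb
      exact i3 j hj hjn (hU _ (hnot _ ha)) (hU _ (hnot _ hb))
  · apply hgood F F' _ f2 f1 f3 0
    · intro ha _
      exact f6 ha
    · intro _ hb
      exact absurd h0 hb
    · intro hb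
      exact absurd h0 hb
  · have hn1 : n - 1 + 1 = n := by omega
    have := hgood F F' _ f2 f1 f3 (n - 1)
    rw [hn1, hxn0] at this
    rw [hxn0]
    apply this
    · intro _ hb
      exact absurd h0 hb
    · intro ha _
      have := f5 _ h0
      simpa [req, oth, hidx 0 (by omega)] using this
    · intro _ hb
      exact absurd h0 hb

lemma Sset_congr {V : Type*} [Fintype V] {r : V} {par : V → V} {c c' : V → ℕ} {u : V}
    (h1 : c u = c' u) (h2 : ∀ v, v ≠ r → par v = u → c v = c' v) :
    Sset r par c u = Sset r par c' u := by
  ext a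
  rw [mem_Sset, mem_Sset, h1]
  constructor
  · rintro (h | ⟨v, a1, a2, a3⟩)
    · exact Or.inl h
    · exact Or.inr ⟨v, a1, a2, (h2 v a1 a2) ▸ a3⟩
  · rintro (h | ⟨v, a1, a2, a3⟩)
    · exact Or.inl h
    · exact Or.inr ⟨v, a1, a2, (h2 v a1 a2) ▸ a3⟩

/-- Stages 1 and 2: colouring of the tree edges. -/
lemma tree_color {V : Type*} [Fintype V] (r : V) (par : V → V) (dep : V → ℕ)
    (hdr : dep r = 0) (hdep : ∀ v, v ≠ r → dep v = dep (par v) + 1)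
    (D : ℕ) (hD : 1 ≤ D) (hDmax : ∀ v, dep v ≤ D)
    (h k Δ : ℕ) (hΔ11 : 11 ≤ Δ) (hh : 5 ≤ h) (hk : k = Δ + h) (hk6 : 2 * h + 6 ≤ k)
    (hΔ : Δ ≤ 2 * h + 1)
    (hchr : (chs r par r).card ≤ Δ) (hchu : ∀ u, u ≠ r → (chs r par u).card + 1 ≤ Δ)
    (L : V → Finset ℕ) (hL : ∀ v, v ≠ r → k ≤ (L v).card)
    (n : ℕ) (hn : 3 ≤ n) (x : ℕ → V) (hxi : ∀ i j, x i = x j ↔ i % n = j % n)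
    (hlf : ∀ v, dep v = D ↔ ∃ j, x j = v) :
    ∃ (c : V → ℕ) (Φ : V → Finset ℕ), Φ r = ∅ ∧
      (∀ v, v ≠ r → c v ∈ L v ∧ c v ∉ Φ (par v) ∧
        ∀ w, w ≠ r → par w = par v → w ≠ v → c w ≠ c v) ∧
      (∀ v, v ≠ r → dep v < D → c v ∈ Φ v ∧
        (∀ w, w ≠ r → par w = par v → w ≠ v → (c w ∈ Φ v ∨ c v ∈ Φ w)) ∧
        (par v ≠ r → c v ∈ Sset r par c (par (par v)) → c (par v) ∈ Φ v) ∧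
        (Sset r par c (par v) \ Φ v).card ≤ h) ∧
      ∀ j, c (x j) ≠ c (x (j + 1)) := by
  obtain ⟨c₀, Φ, hΦr, hinv⟩ := stage_one r par dep hdr hdep h k Δ hh hk hk6 hΔ hchr hchu L hL (D - 1)
  have hxD : ∀ j, dep (x j) = D := fun j => (hlf _).2 ⟨j, rfl⟩
  have hxr : ∀ j, x j ≠ r := by
    intro j hj
    have := hxD j
    rw [hj] at this; omega
  have hxmod : ∀ j, x (j % n) = x j := fun j => (hxi _ _).2 (Nat.mod_mod _ _)
  have hpd : ∀ j, dep (par (x j)) + 1 = D := fun j => by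
    have := hdep _ (hxr j); rw [hxD] at this; omega
  -- stage two
  have hcnt : ∀ u, ((Finset.range n).filter (fun j => par (x j) = u)).card ≤ (chs r par u).card := by
    intro u
    apply Finset.card_le_card_of_injOn x
    · intro j hj
      have hj := (Finset.mem_filter.1 hj).2
      exact mem_chs.2 ⟨hxr j, hj⟩
    · intro i hi j hj hij
      have hi := Finset.mem_range.1 (Finset.mem_filter.1 hi).1
      have hj := Finset.mem_range.1 (Finset.mem_filter.1 hj).1
      have := (hxi _ _).1 hij
      rwa [Nat.mod_eq_of_lt hi, Nat.mod_eq_of_lt hj] at this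
  have hl : ∃ l : ℕ → ℕ, (∀ j < n, l j ∈ L (x j) \ Φ (par (x j))) ∧
      (∀ i < n, ∀ j < n, i ≠ j → par (x i) = par (x j) → l i ≠ l j) ∧
      (∀ j, j + 1 < n → l j ≠ l (j + 1)) ∧ l (n - 1) ≠ l 0 := by
    by_cases hD1 : D = 1
    · have hpr : ∀ j, par (x j) = r := by
        intro j
        by_contra hne
        have h1 := hdep _ hne
        have h2 := hpd j
        omega
      apply stage_two n hn Δ (by omega) (fun j => par (x j)) _ (fun j => L (x j) \ Φ (par (x j)))
      · intro j hj
        simp only [hpr, hΦr, Finset.sdiff_empty]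
        have := hL _ (hxr j)
        omega
      · intro u
        refine (hcnt u).trans ?_
        by_cases hu : u = r
        · rw [hu]; exact hchr
        · have := hchu u hu; omega
    · have hpr : ∀ j, par (x j) ≠ r := by
        intro j hj
        have h2 := hpd j
        rw [hj, hdr] at h2
        omega
      apply stage_two n hn (Δ - 1) (by omega) (fun j => par (x j)) _
        (fun j => L (x j) \ Φ (par (x j)))
      · intro j hj
        have h1 := hL _ (hxr j)
        have h2 := (hinv _ (hpr j) (by have := hpd j; omega)).2.2.1
        have h3 := Finset.le_card_sdiff (Φ (par (x j))) (L (x j))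
        omega
      · intro u
        by_cases hu : u = r
        · have : (Finset.range n).filter (fun j => par (x j) = u) = ∅ := by
            apply Finset.filter_eq_empty_iff.2
            intro j _ hj
            exact hpr j (hj.trans hu)
          rw [this]; simp
        · have h1 := hchu u hu
          have h2 := hcnt u
          omega
  obtain ⟨l, l1, l2, l3, l4⟩ := hl
  have hidx : ∃ idx : V → ℕ, ∀ j, idx (x j) = j % n := by
    refine ⟨fun v => if hv : ∃ j, x j = v then hv.choose % n else 0, ?_⟩
    intro j
    have hv : ∃ i, x i = x j := ⟨j, rfl⟩
    simp only [dif_pos hv]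
    exact (hxi _ _).1 hv.choose_spec
  obtain ⟨idx, hidx⟩ := hidx
  let c : V → ℕ := fun v => if dep v = D then l (idx v) else c₀ v
  have hcx : ∀ j, c (x j) = l (j % n) := fun j => by
    simp only [c, if_pos (hxD j), hidx]
  have hc0 : ∀ v, dep v < D → c v = c₀ v := fun v hv => by
    simp only [c, if_neg (show ¬ dep v = D by omega)]
  have hS : ∀ u, dep u + 1 < D → Sset r par c u = Sset r par c₀ u := by
    intro u hu
    apply Sset_congr (hc0 _ (by omega))
    intro v hv hp
    apply hc0
    have := hdep v hv
    rw [hp] at this; omega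
  have hlt : ∀ j, j % n < n := fun j => Nat.mod_lt _ (by omega)
  have hsame : ∀ v w, v ≠ r → w ≠ r → par w = par v → dep w = dep v := by
    intro v w hv hw hp
    rw [hdep v hv, hdep w hw, hp]
  refine ⟨c, Φ, hΦr, ?_, ?_, ?_⟩
  · intro v hv
    by_cases hvD : dep v = D
    · obtain ⟨j, rfl⟩ := (hlf v).1 hvD
      have h1 := Finset.mem_sdiff.1 (l1 _ (hlt j))
      rw [hxmod] at h1
      rw [hcx]
      refine ⟨h1.1, h1.2, ?_⟩
      intro w hw hp hne
      obtain ⟨i, rfl⟩ := (hlf w).1 ((hsame _ _ hv hw hp).trans hvD)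
      rw [hcx]
      apply l2 _ (hlt i) _ (hlt j)
      · intro he; exact hne ((hxi _ _).2 he)
      · rw [hxmod, hxmod]; exact hp
    · have hvD' : dep v < D := lt_of_le_of_ne (hDmax v) hvD
      obtain ⟨a1, a2, a3, a4, a5, a6, a7⟩ := hinv v hv (by omega)
      rw [hc0 v hvD']
      refine ⟨a1, a4, ?_⟩
      intro w hw hp hne
      rw [hc0 w (by rw [hsame _ _ hv hw hp]; exact hvD')]
      exact (a5 w hw hp hne).1
  · intro v hv hvD'
    obtain ⟨a1, a2, a3, a4, a5, a6, a7⟩ := hinv v hv (by omega)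
    have hd := hdep v hv
    rw [hc0 v hvD']
    refine ⟨a2, ?_, ?_, ?_⟩
    · intro w hw hp hne
      rw [hc0 w (by rw [hsame _ _ hv hw hp]; exact hvD')]
      exact (a5 w hw hp hne).2
    · intro hpr
      have hd2 := hdep _ hpr
      rw [hS _ (by omega), hc0 (par v) (by omega)]
      exact a6 hpr
    · rw [hS _ (by omega)]
      exact a7
  · intro j
    rw [hcx, hcx, nx_mod n (by omega)]
    have := hlt j
    split_ifs with he
    · have : j % n = n - 1 := by omega
      rw [this]; exact l4
    · exact l3 _ (by omega)

/-- Stage 3, including the case of a star. -/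
lemma leaf_forb {V : Type*} [Fintype V] (r : V) (par : V → V) (dep : V → ℕ)
    (hdr : dep r = 0) (hdep : ∀ v, v ≠ r → dep v = dep (par v) + 1)
    (D : ℕ) (hD : 1 ≤ D)
    (h k Δ : ℕ) (hh : 5 ≤ h) (hk6 : 2 * h + 6 ≤ k)
    (hΔ : Δ ≤ 2 * h + 1)
    (hchr : (chs r par r).card ≤ Δ) (hchu : ∀ u, u ≠ r → (chs r par u).card + 1 ≤ Δ)
    (n : ℕ) (hn : 3 ≤ n) (x : ℕ → V) (hxi : ∀ i j, x i = x j ↔ i % n = j % n)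
    (hlf : ∀ v, dep v = D ↔ ∃ j, x j = v)
    (c : V → ℕ) (Φ : V → Finset ℕ)
    (hc1 : ∀ v, v ≠ r → c v ∉ Φ (par v) ∧
        ∀ w, w ≠ r → par w = par v → w ≠ v → c w ≠ c v)
    (hc2 : ∀ v, v ≠ r → dep v < D → c v ∈ Φ v ∧ (Sset r par c (par v) \ Φ v).card ≤ h)
    (Bad : V → Prop) (hBad : ∀ v, Bad v ↔ par v ≠ r ∧ c v ∈ Sset r par c (par (par v)))
    (hx0 : Bad (x 0) ∨ ∀ j, ¬ Bad (x j))
    (LE Q : ℕ → Finset ℕ) (hLE : ∀ j, k ≤ (LE j).card) (hQc : ∀ j, (Q j).card ≤ 4)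
    (hQ : ∀ j, c (x j) ∈ Q j ∧ c (x (j + 1)) ∈ Q j) :
    ∃ F : V → Finset ℕ, (∀ v, (F v).card ≤ h) ∧
      (∀ i j, x i ≠ x j → par (x i) = par (x j) → c (x j) ∈ F (x i) ∨ c (x i) ∈ F (x j)) ∧
      (∀ j, Bad (x j) → c (par (x j)) ∈ F (x j)) ∧
      (∀ j, j % 2 = 1 → j + 2 ≤ n → 3 ≤ (LE j \ (F (x j) ∪ F (x (j + 1)) ∪ Q j)).card) ∧
      3 ≤ (LE 0 \ (F (x 0) ∪ F (x 1) ∪ Q 0)).card ∧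
      3 ≤ (LE (n - 1) \ (F (x (n - 1)) ∪ F (x n) ∪ Q (n - 1))).card := by
  have hxD : ∀ j, dep (x j) = D := fun j => (hlf _).2 ⟨j, rfl⟩
  have hxr : ∀ j, x j ≠ r := by
    intro j hj
    have := hxD j
    rw [hj] at this; omega
  have hxmod : ∀ j, x (j % n) = x j := fun j => (hxi _ _).2 (Nat.mod_mod _ _)
  have hpd : ∀ j, dep (par (x j)) + 1 = D := fun j => by
    have := hdep _ (hxr j); rw [hxD] at this; omega
  by_cases hD1 : D = 1
  · have hpr : ∀ j, par (x j) = r := by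
      intro j
      by_contra hne
      have h1 := hdep _ hne
      have h2 := hpd j
      omega
    obtain ⟨F, f1, f2⟩ := circ_lemma h (chs r par r) (by omega) c
    have hm : ∀ j, x j ∈ chs r par r := fun j => mem_chs.2 ⟨hxr j, hpr j⟩
    have hcard : ∀ v, (if v ∈ chs r par r then F v else ∅).card ≤ h := by
      intro v
      split_ifs with hv
      · exact f1 v hv
      · simp
    have hFx : ∀ j, (if x j ∈ chs r par r then F (x j) else ∅) = F (x j) := fun j => if_pos (hm j)
    have hsucc : ∀ j, x j ≠ x (j + 1) := by
      intro j hj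
      have := (hxi _ _).1 hj
      rw [nx_mod n (by omega)] at this
      split_ifs at this <;> omega
    have hgood : ∀ j, 3 ≤ (LE j \ (F (x j) ∪ F (x (j + 1)) ∪ Q j)).card := by
      intro j
      rcases f2 _ (hm j) _ (hm (j + 1)) (hsucc j) with h' | h'
      · exact internal_good h k hk6 _ _ _ _ (hLE j) (f1 _ (hm _)) (f1 _ (hm _)) (hQc j) _
          (hQ j).2 (Or.inl h')
      · exact internal_good h k hk6 _ _ _ _ (hLE j) (f1 _ (hm _)) (f1 _ (hm _)) (hQc j) _
          (hQ j).1 (Or.inr h')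
    refine ⟨fun v => if v ∈ chs r par r then F v else ∅, hcard, ?_, ?_, ?_, ?_, ?_⟩
    · intro i j hne _
      simp only [hFx]
      exact f2 _ (hm i) _ (hm j) hne
    · intro j hb
      exact absurd (hpr j) ((hBad _).1 hb).1
    · intro j _ _
      simp only [hFx]
      exact hgood j
    · simp only [hFx]
      exact hgood 0
    · simp only [hFx]
      have := hgood (n - 1)
      rwa [show n - 1 + 1 = n by omega] at this
  · have hpr : ∀ j, par (x j) ≠ r := by
      intro j hj
      have h2 := hpd j
      rw [hj, hdr] at h2
      omega
    have hstu : ∀ u v, v ∈ (chs r par u).filter (fun v => dep v = D) ↔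
        (∃ j < n, x j = v) ∧ par v = u := by
      intro u v
      rw [Finset.mem_filter, mem_chs]
      constructor
      · rintro ⟨⟨hv, hp⟩, hd⟩
        obtain ⟨j, rfl⟩ := (hlf v).1 hd
        exact ⟨⟨j % n, Nat.mod_lt _ (by omega), hxmod j⟩, hp⟩
      · rintro ⟨⟨j, _, rfl⟩, hp⟩
        exact ⟨⟨hxr j, hp⟩, hxD j⟩
    have hemp : ∀ u, u = r → (chs r par u).filter (fun v => dep v = D) = ∅ := by
      intro u hu
      apply Finset.eq_empty_of_forall_notMem
      intro v hv
      obtain ⟨⟨j, _, rfl⟩, hp⟩ := (hstu _ _).1 hv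
      exact hpr j (hp.trans hu)
    apply stage_three h k hh hk6 n hn x (fun j => (hxi _ _).2 (by simp)) _ par c
      (fun u => (chs r par u).filter (fun v => dep v = D)) hstu _ _ _ Bad _ hx0 LE Q hLE hQc hQ
    · intro i hi j hj hij
      have := (hxi _ _).1 hij
      rwa [Nat.mod_eq_of_lt hi, Nat.mod_eq_of_lt hj] at this
    · intro i j hne hp
      exact (hc1 _ (hxr j)).2 _ (hxr i) hp hne
    · intro u
      by_cases hu : u = r
      · rw [hemp u hu]; simp
      · have h1 := hchu u hu
        have h2 := Finset.card_filter_le (chs r par u) (fun v => dep v = D)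
        omega
    · intro j he
      have h1 := (hc1 _ (hxr j)).1
      have h2 := (hc2 _ (hpr j) (by have := hpd j; omega)).1
      rw [← he] at h2
      exact h1 h2
    · intro u
      by_cases hu : u = r
      · rw [hemp u hu]; simp
      · by_cases hud : dep u < D
        · refine le_trans ?_ (hc2 u hu hud).2
          apply Finset.card_le_card_of_injOn c
          · intro v hv
            obtain ⟨hv, hb⟩ := Finset.mem_filter.1 hv
            obtain ⟨⟨j, _, rfl⟩, hp⟩ := (hstu _ _).1 hv
            have h1 := ((hBad _).1 hb).2
            have h2 := (hc1 _ (hxr j)).1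
            rw [hp] at h1 h2
            exact Finset.mem_sdiff.2 ⟨h1, h2⟩
          · intro v hv w hw hvw
            obtain ⟨hv, _⟩ := Finset.mem_filter.1 hv
            obtain ⟨⟨i, _, rfl⟩, hi⟩ := (hstu _ _).1 hv
            obtain ⟨hw, _⟩ := Finset.mem_filter.1 hw
            obtain ⟨⟨j, _, rfl⟩, hj⟩ := (hstu _ _).1 hw
            by_contra hne
            exact (hc1 _ (hxr j)).2 _ (hxr i) (hi.trans hj.symm) hne hvw
        · have : (chs r par u).filter (fun v => dep v = D) = ∅ := by
            apply Finset.eq_empty_of_forall_notMem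
            intro v hv
            obtain ⟨⟨j, _, rfl⟩, hp⟩ := (hstu _ _).1 hv
            have := hpd j
            rw [hp] at this
            omega
          rw [this]; simp

lemma core_color {V : Type*} [Fintype V] (r : V) (par : V → V) (dep : V → ℕ)
    (hdr : dep r = 0) (hdep : ∀ v, v ≠ r → dep v = dep (par v) + 1)
    (D : ℕ) (hD : 1 ≤ D) (hDmax : ∀ v, dep v ≤ D)
    (h k Δ : ℕ) (hΔ11 : 11 ≤ Δ) (hh : 5 ≤ h) (hk : k = Δ + h) (hk6 : 2 * h + 6 ≤ k)
    (hΔ : Δ ≤ 2 * h + 1)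
    (hchr : (chs r par r).card ≤ Δ) (hchu : ∀ u, u ≠ r → (chs r par u).card + 1 ≤ Δ)
    (LV : V → Finset ℕ) (hLV : ∀ v, v ≠ r → k ≤ (LV v).card)
    (n : ℕ) (hn : 7 ≤ n) (x₀ : ℕ → V) (hxi₀ : ∀ i j, x₀ i = x₀ j ↔ i % n = j % n)
    (hlf₀ : ∀ v, dep v = D ↔ ∃ j, x₀ j = v)
    (L : Sym2 V → Finset ℕ) (hL : ∀ j, k ≤ (L s(x₀ j, x₀ (j + 1))).card) :
    ∃ (t : ℕ) (x : ℕ → V) (c : V → ℕ) (Φ : V → Finset ℕ) (E : ℕ → ℕ),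
      (∀ j, x j = x₀ (j + t)) ∧ (∀ i j, x i = x j ↔ i % n = j % n) ∧
      (∀ v, dep v = D ↔ ∃ j, x j = v) ∧
      (∀ v, v ≠ r → c v ∈ LV v ∧ c v ∈ Φ v ∧ c v ∉ Φ (par v) ∧
        (∀ w, w ≠ r → par w = par v → w ≠ v → c w ≠ c v ∧ (c w ∈ Φ v ∨ c v ∈ Φ w)) ∧
        (par v ≠ r → c v ∈ Sset r par c (par (par v)) → c (par v) ∈ Φ v)) ∧
      (∀ i j, i % n = j % n → E i = E j) ∧
      (∀ j, E j ∈ L s(x j, x (j + 1)) ∧ E j ∉ Φ (x j) ∧ E j ∉ Φ (x (j + 1)) ∧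
        E j ≠ E (j + 1) ∧ ¬ (E j = E (j + 2) ∧ E (j + 1) = E (j + 3)) ∧
        E (j + 1) ≠ c (x j) ∧ E (j + 1) ≠ c (x (j + 3)) ∧ c (x j) ≠ c (x (j + 1))) := by
  obtain ⟨c, Φ, hΦr, hc1, hc2, hc3⟩ := tree_color r par dep hdr hdep D hD hDmax h k Δ hΔ11 hh hk hk6
    hΔ hchr hchu LV hLV n (by omega) x₀ hxi₀ hlf₀
  let Bad : V → Prop := fun v => par v ≠ r ∧ c v ∈ Sset r par c (par (par v))
  obtain ⟨t, ht⟩ : ∃ t, Bad (x₀ t) ∨ ∀ j, ¬ Bad (x₀ j) := by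
    by_cases hb : ∃ t, Bad (x₀ t)
    · obtain ⟨t, ht⟩ := hb; exact ⟨t, Or.inl ht⟩
    · push Not at hb; exact ⟨0, Or.inr hb⟩
  obtain ⟨x, hx⟩ : ∃ x : ℕ → V, ∀ j, x j = x₀ (j + t) := ⟨_, fun _ => rfl⟩
  have hxi : ∀ i j, x i = x j ↔ i % n = j % n := by
    intro i j
    rw [hx, hx, hxi₀]
    exact ⟨fun h => Nat.ModEq.add_right_cancel' (n := n) t h, fun h => Nat.ModEq.add_right (n := n) t h⟩
  have hlf : ∀ v, dep v = D ↔ ∃ j, x j = v := by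
    intro v
    rw [hlf₀]
    constructor
    · rintro ⟨j, rfl⟩
      refine ⟨j + (n - 1) * t, ?_⟩
      rw [hx, hxi₀]
      obtain ⟨m, rfl⟩ : ∃ m, n = m + 1 := ⟨n - 1, by omega⟩
      have : j + (m + 1 - 1) * t + t = j + (m + 1) * t := by
        rw [Nat.add_sub_cancel]; ring
      rw [this, Nat.add_mul_mod_self_left]
    · rintro ⟨j, rfl⟩
      exact ⟨j + t, (hx j).symm⟩
  have hxD : ∀ j, dep (x j) = D := fun j => (hlf _).2 ⟨j, rfl⟩
  have hxr : ∀ j, x j ≠ r := by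
    intro j hj
    have := hxD j
    rw [hj] at this; omega
  have hx0 : Bad (x 0) ∨ ∀ j, ¬ Bad (x j) := by
    rcases ht with ht | ht
    · left; rw [hx, Nat.zero_add]; exact ht
    · right; intro j; rw [hx]; exact ht _
  let LE : ℕ → Finset ℕ := fun j => L s(x j, x (j + 1))
  let Q : ℕ → Finset ℕ := fun j => {c (x (j + (n - 1))), c (x j), c (x (j + 1)), c (x (j + 2))}
  have hLE : ∀ j, k ≤ (LE j).card := by
    intro j
    simp only [LE, hx]
    rw [show j + 1 + t = j + t + 1 by omega]
    exact hL _
  have hQc : ∀ j, (Q j).card ≤ 4 := fun j => Finset.card_le_four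
  obtain ⟨F, f1, f2, f3, f4, f5, f6⟩ := leaf_forb r par dep hdr hdep D hD h k Δ hh hk6 hΔ hchr hchu n
    (by omega) x hxi hlf c Φ (fun v hv => (hc1 v hv).2)
    (fun v hv hd => ⟨(hc2 v hv hd).1, (hc2 v hv hd).2.2.2⟩) Bad (fun v => Iff.rfl) hx0 LE Q hLE hQc
    (fun j => by simp [Q])
  let A : ℕ → Finset ℕ := fun j => LE j \ (F (x j) ∪ F (x (j + 1)) ∪ Q j)
  obtain ⟨ec, e1, e2, e3⟩ := cycle_color n hn A (by
      intro j
      have h1 := hLE j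
      have h2 := Finset.le_card_sdiff (F (x j) ∪ F (x (j + 1)) ∪ Q j) (LE j)
      have h3 := Finset.card_union_le (F (x j) ∪ F (x (j + 1))) (Q j)
      have h4 := Finset.card_union_le (F (x j)) (F (x (j + 1)))
      have h5 := f1 (x j)
      have h6 := f1 (x (j + 1))
      have h7 := hQc j
      simp only [A]
      omega) f4 f5 (by
      have : n - 1 + 1 = n := by omega
      simp only [A, this]
      exact f6)
  have hAx : ∀ j a, x (j % n + a) = x (j + a) := fun j a => (hxi _ _).2 (by simp)
  have hA : ∀ j, A (j % n) = A j := by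
    intro j
    have h0 : x (j % n) = x j := hAx j 0
    simp only [A, LE, Q, hAx, h0]
  have hE : ∀ j, ec (j % n) ∈ A j := by
    intro j
    rw [← hA]
    exact e1 _ (Nat.mod_lt _ (by omega))
  have hE' : ∀ j, ec (j % n) ∈ LE j ∧ ec (j % n) ∉ F (x j) ∧ ec (j % n) ∉ F (x (j + 1)) ∧
      ec (j % n) ∉ Q j := by
    intro j
    have := hE j
    simp only [A, Finset.mem_sdiff, Finset.mem_union] at this
    tauto
  let Ψ : V → Finset ℕ := fun v => if dep v = D then insert (c v) (F v) else Φ v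
  have hΨx : ∀ j, Ψ (x j) = insert (c (x j)) (F (x j)) := fun j => if_pos (hxD j)
  have hΨ : ∀ v, dep v < D → Ψ v = Φ v := fun v hv => if_neg (by omega)
  have hsame : ∀ v w, v ≠ r → w ≠ r → par w = par v → dep w = dep v := by
    intro v w hv hw hp
    rw [hdep v hv, hdep w hw, hp]
  have hQm : ∀ j, ec (j % n) ≠ c (x (j + (n - 1))) ∧ ec (j % n) ≠ c (x j) ∧
      ec (j % n) ≠ c (x (j + 1)) ∧ ec (j % n) ≠ c (x (j + 2)) := by
    intro j
    have := (hE' j).2.2.2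
    simp only [Q, Finset.mem_insert, Finset.mem_singleton, not_or] at this
    exact this
  refine ⟨t, x, c, Ψ, fun j => ec (j % n), hx, hxi, hlf, ?_, ?_, ?_⟩
  · intro v hv
    have hpD : dep (par v) < D := by
      have := hdep v hv
      have := hDmax v
      omega
    obtain ⟨a1, a2, a3⟩ := hc1 v hv
    rw [hΨ _ hpD]
    by_cases hvD : dep v = D
    · obtain ⟨j, rfl⟩ := (hlf v).1 hvD
      refine ⟨a1, ?_, a2, ?_, ?_⟩
      · rw [hΨx]; exact Finset.mem_insert_self _ _
      · intro w hw hp hne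
        obtain ⟨i, rfl⟩ := (hlf w).1 ((hsame _ _ hv hw hp).trans hvD)
        refine ⟨a3 _ hw hp hne, ?_⟩
        rw [hΨx, hΨx]
        rcases f2 i j hne hp with h' | h'
        · exact Or.inr (Finset.mem_insert_of_mem h')
        · exact Or.inl (Finset.mem_insert_of_mem h')
      · intro hp hS
        rw [hΨx]
        exact Finset.mem_insert_of_mem (f3 j ⟨hp, hS⟩)
    · have hvD' : dep v < D := lt_of_le_of_ne (hDmax v) hvD
      obtain ⟨b1, b2, b3, b4⟩ := hc2 v hv hvD'
      rw [hΨ _ hvD']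
      refine ⟨a1, b1, a2, ?_, b3⟩
      intro w hw hp hne
      rw [hΨ w (by rw [hsame _ _ hv hw hp]; exact hvD')]
      exact ⟨a3 w hw hp hne, b2 w hw hp hne⟩
  · intro i j hij
    simp only [hij]
  · intro j
    obtain ⟨g1, g2, g3, g4⟩ := hE' j
    obtain ⟨q1, q2, q3, q4⟩ := hQm j
    obtain ⟨p1, p2, p3, p4⟩ := hQm (j + 1)
    refine ⟨g1, ?_, ?_, e2 j, e3 j, ?_, p4, ?_⟩
    · rw [hΨx, Finset.mem_insert]; tauto
    · rw [hΨx, Finset.mem_insert]; tauto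
    · rwa [show x (j + 1 + (n - 1)) = x j from (hxi _ _).2 (by
        rw [show j + 1 + (n - 1) = j + n by omega]; simp)] at p1
    · rw [hx, hx, show j + 1 + t = j + t + 1 by omega]
      exact hc3 _

lemma star_of_center {V : Type*} (G : SimpleGraph V) (φ : Sym2 V → ℕ)
    (hp : ∀ u a b, G.Adj u a → G.Adj u b → a ≠ b → φ s(u, a) ≠ φ s(u, b))
    (hc : ∀ u a b a' b', G.Adj u a → G.Adj u b → a ≠ b → G.Adj a a' → a' ≠ u → G.Adj b b' → b' ≠ u →
      φ s(a, a') = φ s(u, b) → φ s(b, b') = φ s(u, a) → False) : IsStarEdgeColoring G φ := by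
  have key : ∀ v0 v1 v2 v3 v4, G.Adj v0 v1 → G.Adj v1 v2 → G.Adj v2 v3 → G.Adj v3 v4 → v0 ≠ v2 →
      v1 ≠ v3 → v2 ≠ v4 → ∀ c₁ c₂, (φ s(v0, v1) = c₁ ∨ φ s(v0, v1) = c₂) →
      (φ s(v1, v2) = c₁ ∨ φ s(v1, v2) = c₂) → (φ s(v2, v3) = c₁ ∨ φ s(v2, v3) = c₂) →
      (φ s(v3, v4) = c₁ ∨ φ s(v3, v4) = c₂) → False := by
    intro v0 v1 v2 v3 v4 h1 h2 h3 h4 n1 n2 n3 c₁ c₂ g1 g2 g3 g4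
    have p1 := hp v1 v0 v2 h1.symm h2 n1
    have p2 := hp v2 v1 v3 h2.symm h3 n2
    have p3 := hp v3 v2 v4 h3.symm h4 n3
    have q := hc v2 v1 v3 v0 v4 h2.symm h3 n2 h1.symm n1 h4 n3.symm
    rw [Sym2.eq_swap (a := v1) (b := v0)] at p1 q
    rw [Sym2.eq_swap (a := v2) (b := v1)] at p2 q
    rw [Sym2.eq_swap (a := v3) (b := v2)] at p3
    apply q <;> omega
  refine ⟨?_, ?_, ?_⟩
  · rintro e₁ he₁ e₂ he₂ ⟨hne, v, hv1, hv2⟩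
    obtain ⟨a, rfl⟩ := Sym2.mem_iff_exists.1 hv1
    obtain ⟨b, rfl⟩ := Sym2.mem_iff_exists.1 hv2
    apply hp v a b he₁ he₂
    rintro rfl
    exact hne rfl
  · rintro u v p hpath hlen ⟨c₁, c₂, he⟩
    rcases p with _ | ⟨h1, p⟩
    · simp at hlen
    rcases p with _ | ⟨h2, p⟩
    · simp at hlen
    rcases p with _ | ⟨h3, p⟩
    · simp at hlen
    rcases p with _ | ⟨h4, p⟩
    · simp at hlen
    rcases p with _ | ⟨h5, p⟩
    · simp only [Walk.edges_cons, Walk.edges_nil, List.mem_cons, List.not_mem_nil, or_false,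
        forall_eq_or_imp, forall_eq] at he
      have hn := hpath.support_nodup
      simp only [Walk.support_cons, Walk.support_nil, List.nodup_cons, List.mem_cons,
        List.not_mem_nil, or_false, not_or] at hn
      exact key _ _ _ _ _ h1 h2 h3 h4 (by tauto) (by tauto) (by tauto) c₁ c₂ he.1 he.2.1 he.2.2.1
        he.2.2.2
    · simp at hlen
  · rintro u p hcyc hlen ⟨c₁, c₂, he⟩
    have hn := hcyc.support_nodup
    rcases p with _ | ⟨h1, p⟩
    · simp at hlen
    rcases p with _ | ⟨h2, p⟩
    · simp at hlen
    rcases p with _ | ⟨h3, p⟩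
    · simp at hlen
    rcases p with _ | ⟨h4, p⟩
    · simp at hlen
    rcases p with _ | ⟨h5, p⟩
    · simp only [Walk.edges_cons, Walk.edges_nil, List.mem_cons, List.not_mem_nil, or_false,
        forall_eq_or_imp, forall_eq] at he
      simp only [Walk.support_cons, Walk.support_nil, List.tail_cons, List.nodup_cons, List.mem_cons,
        List.not_mem_nil, or_false, not_or] at hn
      exact key _ _ _ _ _ h1 h2 h3 h4 (by rintro rfl; tauto) (by tauto) (by tauto) c₁ c₂ he.1 he.2.1
        he.2.2.1 he.2.2.2
    · simp at hlen

lemma verify_star {V : Type*} [Fintype V] (H : SimpleGraph V) (r : V) (par : V → V) (dep : V → ℕ)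
    (hdr : dep r = 0) (hdep : ∀ v, v ≠ r → dep v = dep (par v) + 1)
    (D : ℕ) (hD : 1 ≤ D) (hDmax : ∀ v, dep v ≤ D)
    (n : ℕ) (hn : 7 ≤ n) (x : ℕ → V) (hxi : ∀ i j, x i = x j ↔ i % n = j % n)
    (hlf : ∀ v, dep v = D ↔ ∃ j, x j = v)
    (hadj : ∀ a b, H.Adj a b → (b ≠ r ∧ par b = a) ∨ (a ≠ r ∧ par a = b) ∨
      ∃ j, (a = x j ∧ b = x (j + 1)) ∨ (b = x j ∧ a = x (j + 1)))
    (L : Sym2 V → Finset ℕ) (c : V → ℕ) (Φ : V → Finset ℕ) (E : ℕ → ℕ)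
    (hc : ∀ v, v ≠ r → c v ∈ L s(v, par v) ∧ c v ∈ Φ v ∧ c v ∉ Φ (par v) ∧
        (∀ w, w ≠ r → par w = par v → w ≠ v → c w ≠ c v ∧ (c w ∈ Φ v ∨ c v ∈ Φ w)) ∧
        (par v ≠ r → c v ∈ Sset r par c (par (par v)) → c (par v) ∈ Φ v))
    (hEp : ∀ i j, i % n = j % n → E i = E j)
    (hE : ∀ j, E j ∈ L s(x j, x (j + 1)) ∧ E j ∉ Φ (x j) ∧ E j ∉ Φ (x (j + 1)) ∧
        E j ≠ E (j + 1) ∧ ¬ (E j = E (j + 2) ∧ E (j + 1) = E (j + 3)) ∧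
        E (j + 1) ≠ c (x j) ∧ E (j + 1) ≠ c (x (j + 3)) ∧ c (x j) ≠ c (x (j + 1))) :
    ∃ φ : Sym2 V → ℕ, (∀ e ∈ H.edgeSet, φ e ∈ L e) ∧ IsStarEdgeColoring H φ := by
  have hxD : ∀ j, dep (x j) = D := fun j => (hlf _).2 ⟨j, rfl⟩
  have hxr : ∀ j, x j ≠ r := by
    intro j hj
    have := hxD j
    rw [hj] at this; omega
  have hnp : ∀ v, v ≠ r → ∀ j, par v ≠ x j := by
    intro v hv j hj
    have h1 := hdep v hv
    have h2 := hDmax v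
    rw [hj, hxD] at h1
    omega
  -- the colouring
  have hφ : ∃ φ : Sym2 V → ℕ, (∀ v, v ≠ r → φ s(v, par v) = c v) ∧
      ∀ j, φ s(x j, x (j + 1)) = E j := by
    refine ⟨fun e => if ht : ∃ v, v ≠ r ∧ e = s(v, par v) then c ht.choose else
      if hj : ∃ j, e = s(x j, x (j + 1)) then E hj.choose else 0, ?_, ?_⟩
    · intro v hv
      have ht : ∃ w, w ≠ r ∧ s(v, par v) = s(w, par w) := ⟨v, hv, rfl⟩
      simp only [dif_pos ht]
      have h1 := ht.choose_spec
      generalize ht.choose = w at h1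
      obtain ⟨hw, he⟩ := h1
      rcases Sym2.eq_iff.1 he with ⟨h2, _⟩ | ⟨h2, h3⟩
      · rw [h2]
      · have h4 := hdep v hv
        have h5 := hdep w hw
        rw [h3] at h4
        rw [← h2] at h5
        omega
    · intro j
      have ht : ¬ ∃ w, w ≠ r ∧ s(x j, x (j + 1)) = s(w, par w) := by
        rintro ⟨w, hw, he⟩
        rcases Sym2.eq_iff.1 he with ⟨_, h2⟩ | ⟨h2, _⟩
        · exact hnp w hw _ h2.symm
        · exact hnp w hw _ h2.symm
      have hj : ∃ i, s(x j, x (j + 1)) = s(x i, x (i + 1)) := ⟨j, rfl⟩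
      simp only [dif_neg ht, dif_pos hj]
      have h1 := hj.choose_spec
      generalize hj.choose = i at h1
      apply hEp
      rcases Sym2.eq_iff.1 h1 with ⟨h2, _⟩ | ⟨h2, h3⟩
      · exact ((hxi _ _).1 h2).symm
      · have h2 := (hxi _ _).1 h2
        have h3 := (hxi _ _).1 h3
        have h4 : (j + 2) % n = (j + 0) % n := by
          exact (Nat.ModEq.add_right (n := n) 1 h3).trans h2.symm
        have := Nat.ModEq.add_left_cancel' (n := n) j h4
        rw [Nat.ModEq, Nat.mod_eq_of_lt (by omega), Nat.mod_eq_of_lt (by omega)] at this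
        omega
  obtain ⟨φ, φ1, φ2⟩ := hφ
  have φ1' : ∀ v, v ≠ r → φ s(par v, v) = c v := fun v hv => by rw [Sym2.eq_swap, φ1 v hv]
  have φ2' : ∀ j, φ s(x (j + 1), x j) = E j := fun v => by rw [Sym2.eq_swap, φ2]
  have hshift : ∀ j, ∃ m, x j = x (m + 2) := fun j => ⟨j + 2 * n - 2, (hxi _ _).2 (by
    rw [show j + 2 * n - 2 + 2 = j + 2 * n by omega]; simp)⟩
  have hshift1 : ∀ j, ∃ m, (m + 1) % n = j % n := fun j => ⟨j + 2 * n - 1, by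
    rw [show j + 2 * n - 1 + 1 = j + 2 * n by omega]; simp⟩
  -- neighbours of a leaf
  have hleaf : ∀ m b, H.Adj (x (m + 1)) b → b = par (x (m + 1)) ∨ b = x m ∨ b = x (m + 2) := by
    intro m b hab
    rcases hadj _ _ hab with ⟨hb, hp⟩ | ⟨_, hp⟩ | ⟨j, ⟨h1, h2⟩ | ⟨h1, h2⟩⟩
    · exact absurd hp (hnp b hb _)
    · exact Or.inl hp.symm
    · right; right
      rw [h2]
      exact (hxi _ _).2 (Nat.ModEq.add_right (n := n) 1 ((hxi _ _).1 h1)).symm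
    · right; left
      rw [h1]
      exact (hxi _ _).2 (Nat.ModEq.add_right_cancel' (n := n) 1 ((hxi _ _).1 h2)).symm
  -- neighbours of any vertex
  have hnb : ∀ u a, H.Adj u a → (a ≠ r ∧ par a = u) ∨ (u ≠ r ∧ par u = a) ∨
      ∃ m, u = x (m + 2) ∧ (a = x (m + 1) ∨ a = x (m + 3)) := by
    intro u a hua
    rcases hadj _ _ hua with h1 | h1 | ⟨j, hj⟩
    · exact Or.inl h1
    · exact Or.inr (Or.inl h1)
    · have : ∃ i, u = x i := by
        rcases hj with h | h
        · exact ⟨_, h.1⟩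
        · exact ⟨_, h.2⟩
      obtain ⟨i, hi⟩ := this
      obtain ⟨m, hm⟩ := hshift i
      rw [hm] at hi
      subst hi
      rcases hleaf (m + 1) a hua with h1 | h1 | h1
      · exact Or.inr (Or.inl ⟨hxr _, h1.symm⟩)
      · exact Or.inr (Or.inr ⟨m, rfl, Or.inl h1⟩)
      · exact Or.inr (Or.inr ⟨m, rfl, Or.inr h1⟩)
  -- extension colours
  have hext : ∀ v a, v ≠ r → H.Adj v a → a ≠ par v → φ s(v, a) ∉ Φ v := by
    intro v a hv hva hne
    rcases hnb v a hva with ⟨h1, rfl⟩ | ⟨_, h2⟩ | ⟨m, rfl, rfl | rfl⟩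
    · rw [φ1' a h1]
      exact (hc a h1).2.2.1
    · exact absurd h2.symm hne
    · rw [φ2']
      exact (hE _).2.2.1
    · rw [φ2]
      exact (hE _).2.1
  have hpext : ∀ u a, u ≠ r → H.Adj (par u) a → φ s(par u, a) ∈ Sset r par c (par u) := by
    intro u a hu hua
    rw [mem_Sset]
    rcases hnb _ a hua with ⟨h1, h2⟩ | ⟨h1, rfl⟩ | ⟨m, h1, _⟩
    · right
      refine ⟨a, h1, h2, ?_⟩
      rw [← h2, φ1' a h1]
    · exact Or.inl ⟨h1, φ1 _ h1⟩
    · exact absurd h1 (hnp u hu _)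
  have hEm : ∀ m, E m ≠ c (x (m + 2)) := by
    intro m
    obtain ⟨i, hi⟩ := hshift1 m
    have := (hE i).2.2.2.2.2.2.1
    rw [hEp (i + 1) m hi, show x (i + 3) = x (m + 2) from (hxi _ _).2
      (Nat.ModEq.add_right (n := n) 2 hi)] at this
    exact this
  refine ⟨φ, ?_, star_of_center H φ ?_ ?_⟩
  · intro e he
    induction e using Sym2.ind with
    | _ a b =>
      rcases hadj a b he with ⟨h1, rfl⟩ | ⟨h1, rfl⟩ | ⟨j, ⟨rfl, rfl⟩ | ⟨rfl, rfl⟩⟩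
      · rw [Sym2.eq_swap, φ1 _ h1]
        exact (hc _ h1).1
      · rw [φ1 _ h1]
        exact (hc _ h1).1
      · rw [φ2]
        exact (hE j).1
      · rw [Sym2.eq_swap, φ2]
        exact (hE j).1
  · -- properness
    have hpar : ∀ u b, u ≠ r → H.Adj u b → par u ≠ b → φ s(u, par u) ≠ φ s(u, b) := by
      intro u b hu hub hne he
      have := hext u b hu hub hne.symm
      rw [← he, φ1 u hu] at this
      exact this (hc u hu).2.1
    intro u a b hua hub hab
    rcases hnb u a hua with ⟨ha, rfl⟩ | ⟨ha, rfl⟩ | ⟨m, rfl, hm⟩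
    · rcases hnb _ b hub with ⟨hb, hb'⟩ | ⟨hb, rfl⟩ | ⟨m, h1, _⟩
      · rw [φ1' a ha, ← hb', φ1' b hb]
        exact ((hc b hb).2.2.2.1 a ha hb'.symm hab).1
      · exact (hpar _ a hb hua hab.symm).symm
      · exact absurd h1 (hnp a ha _)
    · exact hpar u b ha hub hab
    · rcases hleaf (m + 1) b hub with rfl | hb | hb
      · exact (hpar _ a (hxr _) hua hab.symm).symm
      · rcases hm with rfl | rfl
        · exact absurd hb.symm hab
        · subst hb
          rw [φ2, φ2']
          exact (hE _).2.2.2.1.symm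
      · rcases hm with rfl | rfl
        · subst hb
          rw [φ2, φ2']
          exact (hE _).2.2.2.1
        · exact absurd hb.symm hab
  · -- centre condition
    have hpar : ∀ u b a' b', u ≠ r → H.Adj u b → par u ≠ b → H.Adj (par u) a' → a' ≠ u →
        H.Adj b b' → b' ≠ u → φ s(par u, a') = φ s(u, b) → φ s(b, b') = φ s(u, par u) → False := by
      intro u b a' b' hu hub hne haa ha' hbb hb' e1 e2
      rw [φ1 u hu] at e2
      rcases hnb u b hub with ⟨hb, rfl⟩ | ⟨_, h2⟩ | ⟨m, rfl, rfl | rfl⟩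
      · rw [φ1' b hb] at e1
        have h1 := hpext _ a' hu haa
        rw [e1] at h1
        have h2 := (hc b hb).2.2.2.2 hu h1
        have h3 := hext b b' hb hbb hb'
        rw [e2] at h3
        exact h3 h2
      · exact hne h2
      · rcases hleaf m b' hbb with rfl | rfl | rfl
        · rw [φ1 _ (hxr _)] at e2
          exact (hE (m + 1)).2.2.2.2.2.2.2 e2
        · rw [φ2'] at e2
          exact hEm m e2
        · exact hb' rfl
      · rcases hleaf (m + 2) b' hbb with rfl | rfl | rfl
        · rw [φ1 _ (hxr _)] at e2
          exact (hE (m + 2)).2.2.2.2.2.2.2 e2.symm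
        · exact hb' rfl
        · rw [φ2] at e2
          exact (hE (m + 2)).2.2.2.2.2.1 e2
    have hcyc : ∀ m a' b', H.Adj (x (m + 1)) a' → a' ≠ x (m + 2) → H.Adj (x (m + 3)) b' →
        b' ≠ x (m + 2) → φ s(x (m + 1), a') = φ s(x (m + 2), x (m + 3)) →
        φ s(x (m + 3), b') = φ s(x (m + 2), x (m + 1)) → False := by
      intro m a' b' haa ha' hbb hb' e1 e2
      rw [φ2 (m + 2)] at e1
      rw [φ2' (m + 1)] at e2
      rcases hleaf m a' haa with rfl | rfl | rfl
      · rw [φ1 _ (hxr _)] at e1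
        exact (hE (m + 1)).2.2.2.2.2.1 e1.symm
      · rcases hleaf (m + 2) b' hbb with rfl | rfl | rfl
        · rw [φ1 _ (hxr _)] at e2
          exact hEm (m + 1) e2.symm
        · exact hb' rfl
        · rw [φ2'] at e1
          rw [φ2 (m + 3)] at e2
          exact (hE m).2.2.2.2.1 ⟨e1, e2.symm⟩
      · exact ha' rfl
    intro u a b a' b' hua hub hab haa ha' hbb hb' e1 e2
    rcases hnb u a hua with ⟨ha, rfl⟩ | ⟨ha, rfl⟩ | ⟨m, rfl, hm⟩
    · rcases hnb _ b hub with ⟨hb, hb2⟩ | ⟨hb, rfl⟩ | ⟨m, h1, _⟩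
      · rw [← hb2, φ1' b hb] at e1
        rw [φ1' a ha] at e2
        have h1 := hext a a' ha haa ha'
        have h2 := hext b b' hb hbb (hb2 ▸ hb')
        rw [e1] at h1
        rw [e2] at h2
        rcases ((hc b hb).2.2.2.1 a ha hb2.symm hab).2 with h3 | h3
        · exact h2 h3
        · exact h1 h3
      · exact hpar _ a b' a' hb hua hab.symm hbb hb' haa ha' e2 e1
      · exact absurd h1 (hnp a ha _)
    · exact hpar u b a' b' ha hub hab haa ha' hbb hb' e1 e2
    · rcases hleaf (m + 1) b hub with rfl | hb | hb
      · exact hpar _ a b' a' (hxr _) hua hab.symm hbb hb' haa ha' e2 e1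
      · rcases hm with rfl | rfl
        · exact absurd hb.symm hab
        · subst hb
          exact hcyc m b' a' hbb hb' haa ha' e2 e1
      · rcases hm with rfl | rfl
        · subst hb
          exact hcyc m a' b' haa ha' hbb hb' e1 e2
        · exact absurd hb.symm hab

lemma cycle_enum {V : Type*} [Fintype V] (C : SimpleGraph V)
    (h02 : ∀ v, C.degree v = 0 ∨ C.degree v = 2)
    (hr : ∀ u v, C.degree u = 2 → C.degree v = 2 → C.Reachable u v)
    (v₀ : V) (hv₀ : C.degree v₀ = 2) :
    ∃ (n : ℕ) (x : ℕ → V), 3 ≤ n ∧ (∀ i j, x i = x j ↔ i % n = j % n) ∧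
      (∀ v, C.degree v = 2 ↔ ∃ j, x j = v) ∧ (∀ j, C.Adj (x j) (x (j + 1))) ∧
      (∀ a b, C.Adj a b → ∃ j, (a = x j ∧ b = x (j + 1)) ∨ (b = x j ∧ a = x (j + 1))) := by
  have hcyc : C.IsCycles := by
    intro v hv
    rcases h02 v with h | h
    · exact absurd hv (by
        rw [← SimpleGraph.degree_pos_iff_nonempty]; omega)
    · rw [← h, ← SimpleGraph.card_neighborSet_eq_degree, Set.ncard_eq_toFinset_card', Set.toFinset_card]
  have hpos : ∀ v, C.degree v = 2 ↔ ∃ w, C.Adj v w := by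
    intro v
    rw [← SimpleGraph.degree_pos_iff_exists_adj]
    rcases h02 v with h | h <;> omega
  obtain ⟨p, hp, hps⟩ := hcyc.exists_cycle_toSubgraph_verts_eq_connectedComponentSupp
    (c := C.connectedComponentMk v₀) (v := v₀) rfl ((SimpleGraph.degree_pos_iff_nonempty).1 (by omega))
  have hn3 := hp.three_le_length
  obtain ⟨n, hn⟩ : ∃ n, n = p.length := ⟨_, rfl⟩
  rw [← hn] at hn3
  have hlt : ∀ j, j % n < n := fun j => Nat.mod_lt _ (by omega)
  obtain ⟨x, hx⟩ : ∃ x : ℕ → V, ∀ j, x j = p.getVert (j % n) := ⟨_, fun _ => rfl⟩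
  have hxi : ∀ i j, x i = x j ↔ i % n = j % n := by
    intro i j
    rw [hx, hx]
    constructor
    · intro h
      have h1 := hlt i
      have h2 := hlt j
      exact hp.getVert_injOn' (by simp only [Set.mem_ofPred_eq]; omega)
        (by simp only [Set.mem_ofPred_eq]; omega) h
    · intro h; rw [h]
  have hxadj : ∀ j, C.Adj (x j) (x (j + 1)) := by
    intro j
    have h1 := hlt j
    have h2 := p.adj_getVert_succ (i := j % n) (by omega)
    rw [hx, hx, nx_mod n (by omega)]
    split_ifs with he
    · rw [show j % n + 1 = p.length by omega, p.getVert_length] at h2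
      rwa [p.getVert_zero]
    · exact h2
  have hdeg : ∀ v, C.degree v = 2 ↔ ∃ j, x j = v := by
    intro v
    constructor
    · intro hv
      have h1 : v ∈ (C.connectedComponentMk v₀).supp :=
        SimpleGraph.ConnectedComponent.sound (hr v v₀ hv hv₀)
      rw [← hps, Walk.mem_verts_toSubgraph, Walk.mem_support_iff_exists_getVert] at h1
      obtain ⟨i, hi, hil⟩ := h1
      by_cases hi' : i = n
      · refine ⟨0, ?_⟩
        rw [hx, Nat.zero_mod, p.getVert_zero, ← hi, hi', hn, p.getVert_length]
      · exact ⟨i, by rw [hx, Nat.mod_eq_of_lt (by omega), hi]⟩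
    · rintro ⟨j, rfl⟩
      exact (hpos _).2 ⟨_, hxadj j⟩
  refine ⟨n, x, hn3, hxi, hdeg, hxadj, ?_⟩
  intro a b hab
  obtain ⟨j, hj⟩ := (hdeg a).1 ((hpos a).2 ⟨b, hab⟩)
  obtain ⟨m, hm⟩ : ∃ m, x j = x (m + 1) := ⟨j + n - 1, (hxi _ _).2 (by
    rw [show j + n - 1 + 1 = j + n by omega]; simp)⟩
  rw [hm] at hj
  subst hj
  have hd := (hdeg _).2 ⟨m + 1, rfl⟩
  have hne : x m ≠ x (m + 2) := by
    intro h
    have h1 : (m + 0) % n = (m + 2) % n := (hxi _ _).1 h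
    have := Nat.ModEq.add_left_cancel' (n := n) m h1
    rw [Nat.ModEq, Nat.mod_eq_of_lt (by omega), Nat.mod_eq_of_lt (by omega)] at this
    omega
  have hsub : ({x m, x (m + 2)} : Finset V) ⊆ C.neighborFinset (x (m + 1)) := by
    intro w hw
    rw [SimpleGraph.mem_neighborFinset]
    rcases Finset.mem_insert.1 hw with rfl | hw
    · exact (hxadj m).symm
    · rw [Finset.mem_singleton.1 hw]; exact hxadj (m + 1)
  have heq := Finset.eq_of_subset_of_card_le hsub (by
    rw [SimpleGraph.card_neighborFinset_eq_degree, hd, Finset.card_pair hne])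
  have hb : b ∈ C.neighborFinset (x (m + 1)) := (SimpleGraph.mem_neighborFinset _ _ _).2 hab
  rw [← heq, Finset.mem_insert, Finset.mem_singleton] at hb
  rcases hb with rfl | rfl
  · exact ⟨m, Or.inr ⟨rfl, rfl⟩⟩
  · exact ⟨m + 1, Or.inl ⟨rfl, rfl⟩⟩

lemma tree_parent {V : Type*} [Fintype V] (T : SimpleGraph V) (hT : T.IsTree) (r : V) :
    ∃ par : V → V, (∀ v, v ≠ r → T.Adj v (par v) ∧ T.dist r v = T.dist r (par v) + 1) ∧
      ∀ a b, T.Adj a b → (b ≠ r ∧ par b = a) ∨ (a ≠ r ∧ par a = b) := by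
  have huniq : ∀ v a b, T.Adj v a → T.Adj v b → T.dist r v = T.dist r a + 1 →
      T.dist r v = T.dist r b + 1 → a = b := by
    intro v a b ha hb hda hdb
    obtain ⟨p, hp⟩ := hT.connected.exists_walk_length_eq_dist r a
    obtain ⟨q, hq⟩ := hT.connected.exists_walk_length_eq_dist r b
    have hp1 : (p.concat ha.symm).IsPath := Walk.isPath_of_length_eq_dist _ (by
      rw [Walk.length_concat, hp, hda])
    have hq1 : (q.concat hb.symm).IsPath := Walk.isPath_of_length_eq_dist _ (by
      rw [Walk.length_concat, hq, hdb])
    have he := (hT.existsUnique_path r v).unique hp1 hq1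
    have := congrArg Walk.penultimate he
    simpa using this
  have hex : ∀ v, ∃ w, v ≠ r → T.Adj v w ∧ T.dist r v = T.dist r w + 1 := by
    intro v
    by_cases hv : v = r
    · exact ⟨v, fun h => absurd hv h⟩
    · obtain ⟨p, hp⟩ := hT.connected.exists_walk_length_eq_dist r v
      have hpos := hT.connected.pos_dist_of_ne (Ne.symm hv)
      have hnil : ¬ p.Nil := by
        intro h
        have := Walk.length_eq_zero_iff.2 h
        omega
      refine ⟨p.penultimate, fun _ => ⟨(p.adj_penultimate hnil).symm, ?_⟩⟩
      have h1 : T.dist r p.penultimate ≤ p.dropLast.length := SimpleGraph.dist_le _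
      rw [Walk.length_dropLast] at h1
      rcases hT.dist_eq_dist_add_one_of_adj r (p.adj_penultimate hnil) with h2 | h2 <;> omega
  choose par hpar using hex
  refine ⟨par, hpar, ?_⟩
  intro a b hab
  rcases hT.dist_eq_dist_add_one_of_adj r hab with h | h
  · right
    have hne : a ≠ r := by
      rintro rfl
      rw [SimpleGraph.dist_self] at h; omega
    exact ⟨hne, huniq a _ _ (hpar a hne).1 hab (hpar a hne).2 h⟩
  · left
    have hne : b ≠ r := by
      rintro rfl
      rw [SimpleGraph.dist_self] at h; omega
    exact ⟨hne, huniq b _ _ (hpar b hne).1 hab.symm (hpar b hne).2 h⟩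

lemma many_leaves {V : Type*} [Fintype V] (T : SimpleGraph V) (hT : T.IsTree)
    (h2 : ∀ v, T.degree v ≠ 2) (w : V) (hw : 7 ≤ T.degree w) :
    7 ≤ (Finset.univ.filter (fun v => T.degree v = 1)).card := by
  have h1 := T.sum_degrees_eq_twice_card_edges
  have h3 := hT.card_edgeFinset
  have : Nontrivial V := by
    have : 0 < T.degree w := by omega
    obtain ⟨u, hu⟩ := (T.degree_pos_iff_exists_adj w).1 this
    exact ⟨w, u, hu.ne⟩
  have hpos : ∀ v, 1 ≤ T.degree v := fun v => hT.connected.preconnected.degree_pos_of_nontrivial v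
  have hle : ∀ v, (3 + if v = w then 4 else 0) ≤ T.degree v + (if T.degree v = 1 then 2 else 0) := by
    intro v
    have a1 := hpos v
    have a2 := h2 v
    by_cases hv : v = w
    · subst hv
      split_ifs <;> omega
    · split_ifs <;> omega
  have h4 := Finset.sum_le_sum (fun v (_ : v ∈ Finset.univ) => hle v)
  rw [Finset.sum_add_distrib, Finset.sum_add_distrib, Finset.sum_const, Finset.sum_ite_eq', h1,
    ← Finset.sum_filter, Finset.sum_const] at h4
  simp only [Finset.card_univ, Finset.mem_univ, if_true, smul_eq_mul] at h4
  have h5 : T.edgeFinset.card + 1 = Fintype.card V := h3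
  have h6 := T.degree_lt_card_verts w
  omega

lemma halin_choosable {V : Type*} [Fintype V] (H T C : SimpleGraph V)
    (hH : IsCompleteHalin H T C) (hΔ : 11 ≤ H.maxDegree) :
    StarChoosable H (3 * H.maxDegree / 2) := by
  obtain ⟨⟨⟨hT, -, hHTC, -, hleafC, hC02, hCr⟩, hT2⟩, r, hr⟩ := hH
  intro L hL
  have hTH : T ≤ H := by rw [hHTC]; exact le_sup_left
  have hCH : C ≤ H := by rw [hHTC]; exact le_sup_right
  have hHadj : ∀ a b, H.Adj a b → T.Adj a b ∨ C.Adj a b := by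
    intro a b h; rw [hHTC] at h; exact h
  have hTdeg : ∀ v, T.degree v ≤ H.maxDegree := fun v =>
    le_trans (SimpleGraph.degree_le_of_le hTH) (H.degree_le_maxDegree v)
  -- a vertex of large degree
  have hVne : Nonempty V := ⟨r⟩
  obtain ⟨w, hw⟩ := H.exists_maximal_degree_vertex
  have hsum : H.degree w ≤ T.degree w + C.degree w := by
    rw [← SimpleGraph.card_neighborFinset_eq_degree, ← SimpleGraph.card_neighborFinset_eq_degree,
      ← SimpleGraph.card_neighborFinset_eq_degree]
    refine le_trans (Finset.card_le_card ?_) (Finset.card_union_le _ _)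
    intro a ha
    rw [Finset.mem_union, SimpleGraph.mem_neighborFinset, SimpleGraph.mem_neighborFinset]
    exact hHadj _ _ ((SimpleGraph.mem_neighborFinset _ _ _).1 ha)
  have hw7 : 7 ≤ T.degree w := by
    rcases hC02 w with h | h <;> omega
  have hleaves := many_leaves T hT hT2 w hw7
  obtain ⟨v₀, hv₀⟩ : ∃ v₀, T.degree v₀ = 1 := by
    have : 0 < (Finset.univ.filter (fun v => T.degree v = 1)).card := by omega
    obtain ⟨v, hv⟩ := Finset.card_pos.1 this
    exact ⟨v, (Finset.mem_filter.1 hv).2⟩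
  have hnt : Nontrivial V := by
    obtain ⟨u, hu⟩ := (T.degree_pos_iff_exists_adj w).1 (by omega)
    exact ⟨w, u, hu.ne⟩
  obtain ⟨n, x, hn3, hxi, hxdeg, hxadj, hCadj⟩ := cycle_enum C hC02 hCr v₀ ((hleafC v₀).1 hv₀)
  have hn7 : 7 ≤ n := by
    refine le_trans hleaves ?_
    have : (Finset.univ.filter (fun v => T.degree v = 1)) ⊆ (Finset.range n).image x := by
      intro v hv
      obtain ⟨j, hj⟩ := (hxdeg v).1 ((hleafC v).1 (Finset.mem_filter.1 hv).2)
      refine Finset.mem_image.2 ⟨j % n, Finset.mem_range.2 (Nat.mod_lt _ (by omega)), ?_⟩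
      rw [← hj]
      exact (hxi _ _).2 (Nat.mod_mod _ _)
    have h1 := Finset.card_le_card this
    have h2 := (Finset.card_image_le (s := Finset.range n) (f := x))
    rw [Finset.card_range] at h2
    omega
  obtain ⟨par, hpar, hTadj⟩ := tree_parent T hT r
  -- depth
  obtain ⟨z, -, hz⟩ := Finset.exists_max_image (Finset.univ : Finset V) (fun v => T.dist r v)
    Finset.univ_nonempty
  have hz : ∀ v, T.dist r v ≤ T.dist r z := fun v => hz v (Finset.mem_univ v)
  have hmaxleaf : ∀ v, T.dist r v = T.dist r z → T.degree v = 1 := by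
    intro v hv
    have h1 : 1 ≤ T.degree v := hT.connected.preconnected.degree_pos_of_nontrivial v
    have h2 : T.degree v ≤ 1 := by
      rw [← SimpleGraph.card_neighborFinset_eq_degree, ← Finset.card_singleton (par v)]
      apply Finset.card_le_card
      intro a ha
      rw [SimpleGraph.mem_neighborFinset] at ha
      rw [Finset.mem_singleton]
      rcases hTadj v a ha with ⟨h3, h4⟩ | ⟨_, h4⟩
      · have h5 := (hpar a h3).2
        have h6 := hz a
        rw [h4] at h5
        omega
      · exact h4.symm
    omega
  have hleafD : ∀ v, T.dist r v = T.dist r z ↔ T.degree v = 1 :=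
    fun v => ⟨hmaxleaf v, fun hv => hr v z hv (hmaxleaf z rfl)⟩
  have hlf : ∀ v, T.dist r v = T.dist r z ↔ ∃ j, x j = v := by
    intro v
    rw [hleafD, hleafC, hxdeg]
  have hD : 1 ≤ T.dist r z := by
    obtain ⟨v, hv⟩ := exists_ne r
    have h1 := hT.connected.pos_dist_of_ne (Ne.symm hv)
    have h2 := hz v
    omega
  have hchr : (chs r par r).card ≤ H.maxDegree := by
    refine le_trans ?_ (hTdeg r)
    rw [← SimpleGraph.card_neighborFinset_eq_degree]
    apply Finset.card_le_card
    intro v hv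
    obtain ⟨h1, h2⟩ := mem_chs.1 hv
    rw [SimpleGraph.mem_neighborFinset]
    have := (hpar v h1).1.symm
    rwa [h2] at this
  have hchu : ∀ u, u ≠ r → (chs r par u).card + 1 ≤ H.maxDegree := by
    intro u hu
    refine le_trans ?_ (hTdeg u)
    have hnot : par u ∉ chs r par u := by
      intro h
      obtain ⟨h1, h2⟩ := mem_chs.1 h
      have h3 := (hpar _ h1).2
      have h4 := (hpar u hu).2
      rw [h2] at h3
      omega
    rw [← Finset.card_insert_of_notMem hnot, ← SimpleGraph.card_neighborFinset_eq_degree]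
    apply Finset.card_le_card
    intro v hv
    rw [SimpleGraph.mem_neighborFinset]
    rcases Finset.mem_insert.1 hv with rfl | hv
    · exact (hpar u hu).1
    · obtain ⟨h1, h2⟩ := mem_chs.1 hv
      have := (hpar v h1).1.symm
      rwa [h2] at this
  obtain ⟨t, y, c, Φ, E, hy, hyi, hylf, hc, hEp, hE⟩ := core_color r par (fun v => T.dist r v)
    SimpleGraph.dist_self (fun v hv => (hpar v hv).2) (T.dist r z) hD hz (H.maxDegree / 2)
    (3 * H.maxDegree / 2) H.maxDegree hΔ (by omega) (by omega) (by omega) (by omega) hchr hchu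
    (fun v => L s(v, par v)) (fun v hv => hL _ (hTH (hpar v hv).1)) n hn7 x hxi hlf L
    (fun j => hL _ (hCH (hxadj j)))
  apply verify_star H r par (fun v => T.dist r v) SimpleGraph.dist_self
    (fun v hv => (hpar v hv).2) (T.dist r z) hD hz n hn7 y hyi hylf _ L c Φ E hc hEp hE
  intro a b hab
  rcases hHadj a b hab with h | h
  · rcases hTadj a b h with h | h
    · exact Or.inl h
    · exact Or.inr (Or.inl h)
  · right; right
    obtain ⟨j, hj⟩ := hCadj a b h
    obtain ⟨i, hi⟩ : ∃ i, (i + t) % n = j % n := by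
      refine ⟨j + (n - 1) * t, ?_⟩
      obtain ⟨m, rfl⟩ : ∃ m, n = m + 1 := ⟨n - 1, by omega⟩
      have : j + (m + 1 - 1) * t + t = j + (m + 1) * t := by
        rw [Nat.add_sub_cancel]; ring
      rw [this, Nat.add_mul_mod_self_left]
    have e1 : y i = x j := by rw [hy]; exact (hxi _ _).2 hi
    have e2 : y (i + 1) = x (j + 1) := by
      rw [hy, show i + 1 + t = i + t + 1 by omega]
      exact (hxi _ _).2 (Nat.ModEq.add_right (n := n) 1 hi)
    exact ⟨i, by rw [e1, e2]; exact hj⟩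

theorem stmt_12 {V : Type*} [Fintype V] (H T C : SimpleGraph V)
    (hH : IsCompleteHalin H T C) (hΔ : 11 ≤ H.maxDegree) :
    listStarChromaticIndex H ≤ 3 * H.maxDegree / 2 :=
  Nat.sInf_le (halin_choosable H T C hH hΔ)
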